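/- Let G be an affine reductive algebraic group over an algebraically closed field k of characteristic zero, Z(G) its center, and φ: G → G/Z(G) the canonical projection. For a subgroup H ⊆ G: (i) H is completely reducible in G if and only if φ(H) is completely reducible in G/Z(G); (ii) H is irreducible in G if and only if φ(H) is irreducible in G/Z(G). -/

import Mathlib

open scoped MatrixGroups

namespace PaperGIT

variable {k : Type} [Field k]

/-- The zero locus in affine space `k^σ` of a set of polynomials. -/
def zeroLocus {σ : Type} (I : Set (MvPolynomial σ k)) : Set (σ → k) :=
  {x | ∀ f ∈ I, MvPolynomial.eval x f = 0}

/-- A subset of affine space is Zariski closed if it is the zero locus of a set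
of polynomials. -/
def IsZClosed {σ : Type} (S : Set (σ → k)) : Prop :=
  ∃ I : Set (MvPolynomial σ k), S = zeroLocus I

/-- The Zariski closure of a subset of affine space. -/
def zClosure {σ : Type} (S : Set (σ → k)) : Set (σ → k) :=
  ⋂₀ {C | IsZClosed C ∧ S ⊆ C}

/-- A matrix viewed as a point of affine space. -/
def mat2pt {n : ℕ} (A : Matrix (Fin n) (Fin n) k) : Fin n × Fin n → k :=
  fun p => A p.1 p.2

/-- An affine algebraic group over `k`, realized (as is always possible) as a
Zariski closed subgroup of some `GL n k`. -/
structure AlgGroup (k : Type) [Field k] where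
  n : ℕ
  toSubgroup : Subgroup (GL (Fin n) k)
  closed : ∃ I : Set (MvPolynomial (Fin n × Fin n) k),
    ∀ A : GL (Fin n) k, A ∈ toSubgroup ↔
      mat2pt (A : Matrix (Fin n) (Fin n) k) ∈ zeroLocus I

/-- A one-parameter subgroup (cocharacter) of `G`: a group homomorphism
`k^× → G` whose matrix entries are Laurent polynomials in the parameter. -/
structure OnePS (G : AlgGroup k) where
  toFun : kˣ →* GL (Fin G.n) k
  mem : ∀ t : kˣ, toFun t ∈ G.toSubgroup
  regular : ∃ p : Fin G.n × Fin G.n → MvPolynomial Bool k,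
    ∀ (t : kˣ) (ij : Fin G.n × Fin G.n),
      (toFun t : Matrix (Fin G.n) (Fin G.n) k) ij.1 ij.2 =
        MvPolynomial.eval (fun b => if b then (t : k) else ((t⁻¹ : kˣ) : k)) (p ij)

/-- `GLimit lam g h` says that the morphism `t ↦ lam(t) * g * lam(t)⁻¹` of `k^×`
into `G` extends to a morphism `k → G` with value `h` at `t = 0`; i.e. that
`lam⁺g = lim_{t→0} lam(t) g lam(t)⁻¹` exists and equals `h`. -/
def GLimit {G : AlgGroup k} (lam : OnePS G) (g h : GL (Fin G.n) k) : Prop :=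
  h ∈ G.toSubgroup ∧
  ∃ q : Fin G.n × Fin G.n → Polynomial k,
    (∀ (t : kˣ) (ij : Fin G.n × Fin G.n),
      ((lam.toFun t * g * (lam.toFun t)⁻¹ : GL (Fin G.n) k) :
          Matrix (Fin G.n) (Fin G.n) k) ij.1 ij.2 = (q ij).eval (t : k)) ∧
    ∀ ij : Fin G.n × Fin G.n,
      (h : Matrix (Fin G.n) (Fin G.n) k) ij.1 ij.2 = (q ij).eval 0

/-- The R-parabolic subgroup `P(λ) = {g ∈ G : lim_{t→0} λ(t) g λ(t)⁻¹ exists}`. -/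
def Pset {G : AlgGroup k} (lam : OnePS G) : Set (GL (Fin G.n) k) :=
  {g | g ∈ G.toSubgroup ∧ ∃ h, GLimit lam g h}

/-- The R-Levi subgroup `L(λ) = {g ∈ G : lim_{t→0} λ(t) g λ(t)⁻¹ = g}`. -/
def Lset {G : AlgGroup k} (lam : OnePS G) : Set (GL (Fin G.n) k) :=
  {g | g ∈ G.toSubgroup ∧ GLimit lam g g}

/-- `L` is an R-Levi subgroup of the R-parabolic subgroup `P`, i.e. `L = L(μ)`
for some one-parameter subgroup `μ` with `P(μ) = P`. -/
def IsRLeviOf {G : AlgGroup k} (L P : Set (GL (Fin G.n) k)) : Prop :=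
  ∃ mu : OnePS G, Pset mu = P ∧ Lset mu = L

/-- `P` is an R-parabolic subgroup of `G`. -/
def IsRParabolic {G : AlgGroup k} (P : Set (GL (Fin G.n) k)) : Prop :=
  ∃ lam : OnePS G, P = Pset lam

/-- Two one-parameter subgroups are opposite if `P(λ) ∩ P(λ')` is an R-Levi
subgroup of both `P(λ)` and `P(λ')`. -/
def AreOpposite {G : AlgGroup k} (lam lam' : OnePS G) : Prop :=
  IsRLeviOf (Pset lam ∩ Pset lam') (Pset lam) ∧
  IsRLeviOf (Pset lam ∩ Pset lam') (Pset lam')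

/-- A subgroup (given as a subset) `H ⊆ G` is completely reducible in `G` if
every R-parabolic subgroup of `G` containing `H` has an R-Levi subgroup
containing `H`. -/
def CompletelyReducible (G : AlgGroup k) (H : Set (GL (Fin G.n) k)) : Prop :=
  ∀ lam : OnePS G, H ⊆ Pset lam →
    ∃ L : Set (GL (Fin G.n) k), IsRLeviOf L (Pset lam) ∧ H ⊆ L

/-- A subgroup (given as a subset) `H ⊆ G` is irreducible in `G` if it is not
contained in any proper R-parabolic subgroup of `G`. -/
def IrreducibleIn (G : AlgGroup k) (H : Set (GL (Fin G.n) k)) : Prop :=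
  ∀ lam : OnePS G, H ⊆ Pset lam → Pset lam = (G.toSubgroup : Set (GL (Fin G.n) k))

/-- The center `Z(G)` of `G`, as a subset. -/
def centerSet (G : AlgGroup k) : Set (GL (Fin G.n) k) :=
  {g | g ∈ G.toSubgroup ∧ ∀ h ∈ G.toSubgroup, g * h = h * g}

/-- The centralizer `Z_G(H)` of a subset `H` in `G`. -/
def centralizerSet (G : AlgGroup k) (H : Set (GL (Fin G.n) k)) :
    Set (GL (Fin G.n) k) :=
  {g | g ∈ G.toSubgroup ∧ ∀ h ∈ H, g * h = h * g}

/-- A subset of `GL n k` which is Zariski closed in `GL n k` (with the subspace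
topology coming from the space of matrices). -/
def ClosedInGL {n : ℕ} (S : Set (GL (Fin n) k)) : Prop :=
  ∃ I : Set (MvPolynomial (Fin n × Fin n) k),
    S = {A : GL (Fin n) k | mat2pt (A : Matrix (Fin n) (Fin n) k) ∈ zeroLocus I}

/-- Zariski connectedness (preconnectedness) of a subset of `GL n k`. -/
def IsConnSet {n : ℕ} (T : Set (GL (Fin n) k)) : Prop :=
  ∀ V W : Set (GL (Fin n) k), ClosedInGL V → ClosedInGL W →
    T ⊆ V ∪ W → T ∩ V ∩ W = ∅ → T ⊆ V ∨ T ⊆ W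

/-- The connected component of the identity of `G`. -/
def idComponent (G : AlgGroup k) : Set (GL (Fin G.n) k) :=
  ⋃₀ {C | C ⊆ (G.toSubgroup : Set (GL (Fin G.n) k)) ∧
      (1 : GL (Fin G.n) k) ∈ C ∧ IsConnSet C}

/-- A unipotent element of `GL n k`. -/
def IsUnipotentEl {n : ℕ} (A : GL (Fin n) k) : Prop :=
  ((A : Matrix (Fin n) (Fin n) k) - 1) ^ n = 0

/-- `G` is reductive: the unipotent radical of the identity component `G⁰` is
trivial, i.e. every connected normal subgroup of `G⁰` consisting of unipotent
elements is trivial. -/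
def IsReductive (G : AlgGroup k) : Prop :=
  ∀ H : Set (GL (Fin G.n) k),
    H ⊆ idComponent G → (1 : GL (Fin G.n) k) ∈ H →
    (∀ a ∈ H, ∀ b ∈ H, a * b ∈ H) → (∀ a ∈ H, a⁻¹ ∈ H) →
    (∀ g ∈ idComponent G, ∀ h ∈ H, g * h * g⁻¹ ∈ H) →
    IsConnSet H → (∀ h ∈ H, IsUnipotentEl h) →
    H = {1}

/-- A semisimple (diagonalizable) element of `GL n k`. -/
def IsSemisimpleEl {n : ℕ} (A : GL (Fin n) k) : Prop :=
  ∃ P : GL (Fin n) k,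
    ((P * A * P⁻¹ : GL (Fin n) k) : Matrix (Fin n) (Fin n) k).IsDiag

/-- A torus in `G`: a Zariski closed connected commutative subgroup all of
whose elements are semisimple. -/
def IsTorusIn (G : AlgGroup k) (T : Set (GL (Fin G.n) k)) : Prop :=
  T ⊆ (G.toSubgroup : Set (GL (Fin G.n) k)) ∧ (1 : GL (Fin G.n) k) ∈ T ∧
  (∀ a ∈ T, ∀ b ∈ T, a * b ∈ T) ∧ (∀ a ∈ T, a⁻¹ ∈ T) ∧
  ClosedInGL T ∧ IsConnSet T ∧
  (∀ a ∈ T, ∀ b ∈ T, a * b = b * a) ∧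
  (∀ a ∈ T, IsSemisimpleEl a)

/-- A maximal torus of `G`. -/
def IsMaximalTorusIn (G : AlgGroup k) (T : Set (GL (Fin G.n) k)) : Prop :=
  IsTorusIn G T ∧ ∀ T' : Set (GL (Fin G.n) k), IsTorusIn G T' → T ⊆ T' → T' = T

/-- A morphism of affine algebraic groups: a group homomorphism on the points
of `G` whose matrix entries are regular functions on `G`. -/
structure AlgGroupHom (G G' : AlgGroup k) where
  toFun : GL (Fin G.n) k → GL (Fin G'.n) k
  mem : ∀ g ∈ G.toSubgroup, toFun g ∈ G'.toSubgroup
  map_one : toFun 1 = 1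
  map_mul : ∀ g ∈ G.toSubgroup, ∀ h ∈ G.toSubgroup, toFun (g * h) = toFun g * toFun h
  regular : ∃ p : Fin G'.n × Fin G'.n → MvPolynomial ((Fin G.n × Fin G.n) ⊕ Unit) k,
    ∀ g ∈ G.toSubgroup, ∀ ij : Fin G'.n × Fin G'.n,
      (toFun g : Matrix (Fin G'.n) (Fin G'.n) k) ij.1 ij.2 =
        MvPolynomial.eval
          (Sum.elim (mat2pt (g : Matrix (Fin G.n) (Fin G.n) k))
            (fun _ => ((g⁻¹ : GL (Fin G.n) k) : Matrix (Fin G.n) (Fin G.n) k).det))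
          (p ij)

/-- Surjectivity of a morphism of algebraic groups (onto the points of `G'`). -/
def AlgGroupHom.Surj {G G' : AlgGroup k} (f : AlgGroupHom G G') : Prop :=
  ∀ g' ∈ G'.toSubgroup, ∃ g ∈ G.toSubgroup, f.toFun g = g'

/-- An affine `G`-variety: a Zariski closed subset of affine space `k^m`
together with an algebraic (polynomially defined) action of `G`. -/
structure GVariety (G : AlgGroup k) (m : ℕ) where
  carrier : Set (Fin m → k)
  closed : IsZClosed carrier
  act : GL (Fin G.n) k → (Fin m → k) → (Fin m → k)
  act_mem : ∀ g ∈ G.toSubgroup, ∀ x ∈ carrier, act g x ∈ carrier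
  act_one : ∀ x ∈ carrier, act 1 x = x
  act_mul : ∀ g ∈ G.toSubgroup, ∀ h ∈ G.toSubgroup, ∀ x ∈ carrier,
    act (g * h) x = act g (act h x)
  regular : ∃ p : Fin m → MvPolynomial ((Fin G.n × Fin G.n) ⊕ (Unit ⊕ Fin m)) k,
    ∀ g ∈ G.toSubgroup, ∀ x ∈ carrier, ∀ i : Fin m,
      act g x i =
        MvPolynomial.eval
          (Sum.elim (mat2pt (g : Matrix (Fin G.n) (Fin G.n) k))
            (Sum.elim
              (fun _ => ((g⁻¹ : GL (Fin G.n) k) : Matrix (Fin G.n) (Fin G.n) k).det)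
              x))
          (p i)

/-- `XLimit X lam x y` : the `lam`-ray through `x`, `t ↦ lam(t)·x`, extends to
a morphism `k → X` with value `y` at `0`; i.e. `lam⁺x` exists and equals `y`. -/
def XLimit {G : AlgGroup k} {m : ℕ} (X : GVariety G m) (lam : OnePS G)
    (x y : Fin m → k) : Prop :=
  y ∈ X.carrier ∧
  ∃ q : Fin m → Polynomial k,
    (∀ (t : kˣ) (i : Fin m), X.act (lam.toFun t) x i = (q i).eval (t : k)) ∧
    ∀ i : Fin m, y i = (q i).eval 0

/-- `lam ∈ Λ_x` : the limit `lam⁺x` exists. -/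
def InLambda {G : AlgGroup k} {m : ℕ} (X : GVariety G m) (x : Fin m → k)
    (lam : OnePS G) : Prop :=
  ∃ y, XLimit X lam x y

/-- `H_x = ∩_{λ ∈ Λ_x} P(λ)`. -/
def Hx {G : AlgGroup k} {m : ℕ} (X : GVariety G m) (x : Fin m → k) :
    Set (GL (Fin G.n) k) :=
  {g | g ∈ G.toSubgroup ∧ ∀ lam : OnePS G, InLambda X x lam → g ∈ Pset lam}

/-- `Λ_x` is symmetric: every `λ ∈ Λ_x` admits an opposite `λ' ∈ Λ_x`. -/
def SymmetricLambda {G : AlgGroup k} {m : ℕ} (X : GVariety G m)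
    (x : Fin m → k) : Prop :=
  ∀ lam : OnePS G, InLambda X x lam →
    ∃ lam' : OnePS G, InLambda X x lam' ∧ AreOpposite lam lam'

/-- The map `η : X → S(G)`, `x ↦ H_x`, is proper: `H_x ⊆ P(λ)` implies `λ ∈ Λ_x`. -/
def EtaProper {G : AlgGroup k} {m : ℕ} (X : GVariety G m) : Prop :=
  ∀ x ∈ X.carrier, ∀ lam : OnePS G, Hx X x ⊆ Pset lam → InLambda X x lam

/-- The `G`-orbit of `x`. -/
def orbitSet {G : AlgGroup k} {m : ℕ} (X : GVariety G m) (x : Fin m → k) :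
    Set (Fin m → k) :=
  {y | ∃ g ∈ G.toSubgroup, y = X.act g x}

/-- `x` is polystable: its `G`-orbit is Zariski closed. -/
def Polystable {G : AlgGroup k} {m : ℕ} (X : GVariety G m) (x : Fin m → k) : Prop :=
  IsZClosed (orbitSet X x)

/-- The stabilizer `G_x` of `x`, as a subset of `G`. -/
def stabSet {G : AlgGroup k} {m : ℕ} (X : GVariety G m) (x : Fin m → k) :
    Set (GL (Fin G.n) k) :=
  {g | g ∈ G.toSubgroup ∧ X.act g x = x}

/-- The center of the action, `G_X = ∩_{x ∈ X} G_x`. -/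
def actionCenter {G : AlgGroup k} {m : ℕ} (X : GVariety G m) :
    Set (GL (Fin G.n) k) :=
  {g | g ∈ G.toSubgroup ∧ ∀ x ∈ X.carrier, X.act g x = x}

/-- `x` is stable: polystable and `G_x/G_X` is finite (finitely many cosets
`g·G_X` with `g ∈ G_x`). -/
def Stable {G : AlgGroup k} {m : ℕ} (X : GVariety G m) (x : Fin m → k) : Prop :=
  Polystable X x ∧
  Set.Finite ((fun g => (fun h => g * h) '' actionCenter X) '' stabSet X x)

/-- `x` is properly stable: polystable with finite stabilizer. -/
def ProperlyStable {G : AlgGroup k} {m : ℕ} (X : GVariety G m) (x : Fin m → k) : Prop :=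
  Polystable X x ∧ (stabSet X x).Finite

/-- `x` is equicentral: polystable and `G_x = G_X`. -/
def Equicentral {G : AlgGroup k} {m : ℕ} (X : GVariety G m) (x : Fin m → k) : Prop :=
  Polystable X x ∧ stabSet X x = actionCenter X

/-- `x` is 1PS stable: polystable, and for every one-parameter subgroup `λ`
of `G` with `λ(k^×) ⊄ G_X` the limit `λ⁺x` does not exist. -/
def OnePSStable {G : AlgGroup k} {m : ℕ} (X : GVariety G m) (x : Fin m → k) : Prop :=
  Polystable X x ∧
  ∀ lam : OnePS G, ¬ (∀ t : kˣ, lam.toFun t ∈ actionCenter X) → ¬ InLambda X x lam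

/-- The weight space of weight `n ∈ ℤ` for the 1PS `lam` acting on `k^m`. -/
def weightSpace {G : AlgGroup k} {m : ℕ} (X : GVariety G m) (lam : OnePS G)
    (n : ℤ) : Set (Fin m → k) :=
  {w | ∀ t : kˣ, X.act (lam.toFun t) w = (((t ^ n : kˣ) : k)) • w}

/-- `μ(v, lam) = μ0`: decomposing `v` into nonzero weight vectors for `lam`,
the minimal occurring weight equals `μ0`. -/
def MuIs {G : AlgGroup k} {m : ℕ} (X : GVariety G m) (lam : OnePS G)
    (v : Fin m → k) (μ0 : ℤ) : Prop :=
  ∃ (s : Finset ℤ) (c : ℤ → (Fin m → k)),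
    (∀ n ∈ s, c n ∈ weightSpace X lam n ∧ c n ≠ 0) ∧
    v = ∑ n ∈ s, c n ∧ μ0 ∈ s ∧ ∀ n ∈ s, μ0 ≤ n

/-- `GL n k` itself, as an affine algebraic group. -/
def fullGL (k : Type) [Field k] (n : ℕ) : AlgGroup k where
  n := n
  toSubgroup := ⊤
  closed := ⟨∅, by intro A; simp [zeroLocus]⟩

/-- A subset `X ⊆ G^N` which is Zariski closed in `G^N`. -/
def GNClosed (G : AlgGroup k) (N : ℕ)
    (S : Set (Fin N → GL (Fin G.n) k)) : Prop :=
  ∃ I : Set (MvPolynomial (Fin N × (Fin G.n × Fin G.n)) k),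
    S = {x | (∀ i, x i ∈ G.toSubgroup) ∧
          ∀ f ∈ I, MvPolynomial.eval
            (fun p => ((x p.1 : Matrix (Fin G.n) (Fin G.n) k) p.2.1 p.2.2)) f = 0}

/-- Limits of the `lam`-ray through `x ∈ X ⊆ G^N`, for the simultaneous
conjugation action. -/
def GNLimit {G : AlgGroup k} {N : ℕ} (X : Set (Fin N → GL (Fin G.n) k))
    (lam : OnePS G) (x y : Fin N → GL (Fin G.n) k) : Prop :=
  y ∈ X ∧
  ∃ q : Fin N → Fin G.n × Fin G.n → Polynomial k,
    (∀ (t : kˣ) (i : Fin N) (ij : Fin G.n × Fin G.n),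
      ((lam.toFun t * x i * (lam.toFun t)⁻¹ : GL (Fin G.n) k) :
          Matrix (Fin G.n) (Fin G.n) k) ij.1 ij.2 = (q i ij).eval (t : k)) ∧
    ∀ (i : Fin N) (ij : Fin G.n × Fin G.n),
      (y i : Matrix (Fin G.n) (Fin G.n) k) ij.1 ij.2 = (q i ij).eval 0

/-- `lam ∈ Λ_x` for `x ∈ X ⊆ G^N`. -/
def GNInLambda {G : AlgGroup k} {N : ℕ} (X : Set (Fin N → GL (Fin G.n) k))
    (x : Fin N → GL (Fin G.n) k) (lam : OnePS G) : Prop :=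
  ∃ y, GNLimit X lam x y

/-- `H_x` for `x ∈ X ⊆ G^N`. -/
def GNHx {G : AlgGroup k} {N : ℕ} (X : Set (Fin N → GL (Fin G.n) k))
    (x : Fin N → GL (Fin G.n) k) : Set (GL (Fin G.n) k) :=
  {g | g ∈ G.toSubgroup ∧ ∀ lam : OnePS G, GNInLambda X x lam → g ∈ Pset lam}

/-- `φ_x`: the subgroup of `G` generated by the components of `x ∈ G^N`. -/
def phiSet {G : AlgGroup k} {N : ℕ} (x : Fin N → GL (Fin G.n) k) :
    Set (GL (Fin G.n) k) :=
  (Subgroup.closure (Set.range x) : Subgroup (GL (Fin G.n) k))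

/-- The orbit of `x ∈ G^N` under simultaneous conjugation. -/
def GNOrbit {G : AlgGroup k} {N : ℕ} (x : Fin N → GL (Fin G.n) k) :
    Set (Fin N → GL (Fin G.n) k) :=
  {y | ∃ g ∈ G.toSubgroup, y = fun i => g * x i * g⁻¹}

/-- Polystability of `x ∈ X ⊆ G^N`: the conjugation orbit is Zariski closed. -/
def GNPolystable (G : AlgGroup k) {N : ℕ} (x : Fin N → GL (Fin G.n) k) : Prop :=
  GNClosed G N (GNOrbit x)

/-- The stabilizer of `x ∈ G^N` under simultaneous conjugation. -/
def GNStab (G : AlgGroup k) {N : ℕ} (x : Fin N → GL (Fin G.n) k) :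
    Set (GL (Fin G.n) k) :=
  {g | g ∈ G.toSubgroup ∧ ∀ i, g * x i * g⁻¹ = x i}

/-- `G_X` for `X ⊆ G^N` with the simultaneous conjugation action. -/
def GNActionCenter (G : AlgGroup k) {N : ℕ}
    (X : Set (Fin N → GL (Fin G.n) k)) : Set (GL (Fin G.n) k) :=
  {g | g ∈ G.toSubgroup ∧ ∀ x ∈ X, ∀ i, g * x i * g⁻¹ = x i}

/-- `x ∈ X ⊆ G^N` is stable: polystable and `G_x/G_X` finite. -/
def GNStable (G : AlgGroup k) {N : ℕ} (X : Set (Fin N → GL (Fin G.n) k))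
    (x : Fin N → GL (Fin G.n) k) : Prop :=
  GNPolystable G x ∧
  Set.Finite ((fun g => (fun h => g * h) '' GNActionCenter G X) '' GNStab G x)

/-- `x ∈ X ⊆ G^N` is equicentral: polystable and `G_x = G_X`. -/
def GNEquicentral (G : AlgGroup k) {N : ℕ} (X : Set (Fin N → GL (Fin G.n) k))
    (x : Fin N → GL (Fin G.n) k) : Prop :=
  GNPolystable G x ∧ GNStab G x = GNActionCenter G X

/-- A subgroup `H ⊆ G` is isotropic: completely reducible with `Z_G(H) = Z(G)`. -/
def IsIsotropic (G : AlgGroup k) (H : Set (GL (Fin G.n) k)) : Prop :=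
  CompletelyReducible G H ∧ centralizerSet G H = centerSet G


section Helpers
open Polynomial


lemma exists_log_poly {k : Type} [Field k] [CharZero k] (E : k[X]) (h0 : E.coeff 0 = 1)
    (h1 : E.coeff 1 = 1) (n : ℕ) :
    ∃ l : k[X], X ∣ l ∧ X ^ n ∣ E.comp l - (1 + X) := by
  have key : ∀ n, ∃ l : k[X], X ∣ l ∧ X ^ (n + 1) ∣ E.comp l - (1 + X) := by
    intro n
    induction n with
    | zero =>
      refine ⟨0, dvd_zero _, ?_⟩
      rw [zero_add, pow_one, X_dvd_iff]
      rw [coeff_zero_eq_eval_zero] at h0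
      simp [coeff_zero_eq_eval_zero, h0]
    | succ n ih =>
      obtain ⟨l, ⟨l', hl⟩, w, hw⟩ := ih
      refine ⟨l + X ^ (n + 1) * (- w), ?_, ?_⟩
      · exact dvd_add ⟨l', hl⟩ (Dvd.dvd.mul_right (dvd_pow_self _ (Nat.succ_ne_zero n)) _)
      · obtain ⟨z, hz⟩ := (E.map C).binomExpansion l (X ^ (n + 1) * (-w))
        have hc : ∀ p q : k[X], (p.map C).eval q = p.comp q := by
          intro p q; rw [eval_map, comp]
        rw [derivative_map] at hz
        simp only [hc] at hz
        have hd : X ∣ (derivative E).comp l - 1 := by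
          rw [X_dvd_iff, coeff_zero_eq_eval_zero]
          simp [eval_comp, hl, ← coeff_zero_eq_eval_zero, coeff_derivative, h1]
        obtain ⟨v, hv⟩ := hd
        rw [hz]
        refine ⟨- v * w + X ^ n * z * w ^ 2, ?_⟩
        rw [eq_add_of_sub_eq hv, eq_add_of_sub_eq hw]
        ring
  cases n with
  | zero => exact ⟨0, dvd_zero _, by simp⟩
  | succ n => exact key n

lemma exists_log {k : Type} [Field k] [CharZero k] (n : ℕ) :
    ∃ l : k[X], X ∣ l ∧ ∀ (A : Type) [Ring A] [Algebra k A] [Algebra ℚ A] (N : A), N ^ n = 0 →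
      IsNilpotent.exp (aeval N l) = 1 + N := by
  let E : k[X] := ∑ i ∈ Finset.range (n + 2), C ((i.factorial : k)⁻¹) * X ^ i
  have hE : ∀ i < n + 2, E.coeff i = (i.factorial : k)⁻¹ := by
    intro i hi
    simp [E, coeff_X_pow]
    omega
  obtain ⟨l, hl, w, hw⟩ := exists_log_poly E (by rw [hE 0 (by omega)]; simp)
    (by rw [hE 1 (by omega)]; simp) n
  refine ⟨l, hl, ?_⟩
  intro A _ _ _ N hN
  have hnil : (aeval N l) ^ (n + 2) = 0 := by
    obtain ⟨l', rfl⟩ := hl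
    rw [← map_pow, mul_pow, map_mul, map_pow, aeval_X, pow_add, hN, zero_mul, zero_mul]
  rw [IsNilpotent.exp_eq_sum hnil]
  have h2 := congrArg (aeval N) hw
  rw [map_sub, map_mul, map_pow, aeval_X, hN, zero_mul, sub_eq_zero, aeval_comp] at h2
  simp only [E, map_sum, map_add, map_one, aeval_X, map_mul, aeval_C, map_pow] at h2
  rw [← h2]
  refine Finset.sum_congr rfl fun i _ => ?_
  rw [← Algebra.smul_def, inv_natCast_smul_eq ℚ k]


lemma diag_of_basis {k : Type} [Field k] {n : ℕ} (s : Matrix (Fin n) (Fin n) k)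
    (b : Module.Basis (Fin n) k (Fin n → k)) (d : Fin n → k)
    (hb : ∀ i, Matrix.toLin' s (b i) = d i • b i) :
    ∃ (Q : GL (Fin n) k) (d : Fin n → k), s = Q * Matrix.diagonal d * (Q⁻¹ : GL (Fin n) k) := by
  let P := (Pi.basisFun k (Fin n)).toMatrix b
  let P' := b.toMatrix (Pi.basisFun k (Fin n))
  refine ⟨⟨P, P', Module.Basis.toMatrix_mul_toMatrix_flip _ _, Module.Basis.toMatrix_mul_toMatrix_flip _ _⟩, d, ?_⟩
  have h1 : s * P = P * Matrix.diagonal d := by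
    ext i j
    have := congrFun (hb j) i
    simp only [Matrix.toLin'_apply, Matrix.mulVec, dotProduct, Pi.smul_apply, smul_eq_mul] at this
    rw [Matrix.mul_diagonal, mul_comm, Matrix.mul_apply]
    exact this
  change s = P * Matrix.diagonal d * P'
  rw [← h1, mul_assoc, Module.Basis.toMatrix_mul_toMatrix_flip, mul_one]

lemma exists_diag {k : Type} [Field k] [IsAlgClosed k] {n : ℕ} (s : Matrix (Fin n) (Fin n) k)
    (hs : Module.End.IsSemisimple (Matrix.toLin' s)) :
    ∃ (Q : GL (Fin n) k) (d : Fin n → k), s = Q * Matrix.diagonal d * (Q⁻¹ : GL (Fin n) k) := by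
  classical
  have htop := hs.iSup_eigenspace_eq_top
  have hintern : DirectSum.IsInternal (Module.End.eigenspace (Matrix.toLin' s)) :=
    (DirectSum.isInternal_submodule_iff_iSupIndep_and_iSup_eq_top _).2
      ⟨Module.End.eigenspaces_iSupIndep _, htop⟩
  let b0 := hintern.collectedBasis (fun μ => Module.finBasis k _)
  have hmem : ∀ a, Matrix.toLin' s (b0 a) = a.1 • b0 a := fun a =>
    Module.End.mem_eigenspace_iff.1 (hintern.collectedBasis_mem (fun μ => Module.finBasis k _) a)
  have := Module.Finite.finite_basis b0
  have := Fintype.ofFinite (Σ μ : k, Fin (Module.finrank k (Module.End.eigenspace (Matrix.toLin' s) μ)))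
  have hcard : Fintype.card (Σ μ : k, Fin (Module.finrank k (Module.End.eigenspace (Matrix.toLin' s) μ))) = n := by
    rw [← Module.finrank_eq_card_basis b0]; simp
  let e := Fintype.equivFinOfCardEq hcard
  let b := b0.reindex e
  let d : Fin n → k := fun i => (e.symm i).1
  have hb : ∀ i, Matrix.toLin' s (b i) = d i • b i := fun i => by
    simp only [b, Module.Basis.reindex_apply, hmem, d]
  exact diag_of_basis s b d hb

lemma exists_jordan_add {k : Type} [Field k] [IsAlgClosed k] {n : ℕ}
    (g : Matrix (Fin n) (Fin n) k) :
    ∃ (Q : GL (Fin n) k) (d : Fin n → k) (N : Matrix (Fin n) (Fin n) k), IsNilpotent N ∧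
      g = N + Q * Matrix.diagonal d * (Q⁻¹ : GL (Fin n) k) ∧
      Commute N (Q * Matrix.diagonal d * (Q⁻¹ : GL (Fin n) k)) := by
  obtain ⟨N, hN, s, hs, hnil, hss, h⟩ :=
    Module.End.exists_isNilpotent_isSemisimple (f := Matrix.toLin' g)
  have hcomm : Commute N s := Algebra.commute_of_mem_adjoin_singleton_of_commute hs
    (Algebra.commute_of_mem_adjoin_singleton_of_commute hN (Commute.refl _)).symm
  obtain ⟨Q, d, hd⟩ := exists_diag (LinearMap.toMatrix' s) (by simpa using hss)
  refine ⟨Q, d, LinearMap.toMatrix' N, ?_, ?_, ?_⟩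
  · exact hnil.map (LinearMap.toMatrixAlgEquiv' (R := k) (n := Fin n))
  · rw [← hd, ← map_add, ← h]; simp
  · rw [← hd]
    exact hcomm.map (LinearMap.toMatrixAlgEquiv' (R := k) (n := Fin n))


lemma isUnit_diag {k : Type} [Field k] {n : ℕ} (d : Fin n → k) (h : IsUnit (Matrix.diagonal d)) :
    ∀ i, d i ≠ 0 := by
  rw [Matrix.isUnit_iff_isUnit_det, Matrix.det_diagonal, isUnit_iff_ne_zero,
    Finset.prod_ne_zero_iff] at h
  exact fun i => h i (Finset.mem_univ i)

/-- invertible diagonal matrix -/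
def diagGL {R : Type} [CommRing R] {n : ℕ} : (Fin n → Rˣ) →* GL (Fin n) R :=
  (Units.map (Matrix.diagonalRingHom (Fin n) R).toMonoidHom).comp
    (MulEquiv.piUnits (M := fun _ : Fin n => R)).symm.toMonoidHom

lemma diagGL_val {R : Type} [CommRing R] {n : ℕ} (d : Fin n → Rˣ) :
    (diagGL d : Matrix (Fin n) (Fin n) R) = Matrix.diagonal (fun i => (d i : R)) := rfl

lemma exists_jordan {k : Type} [Field k] [IsAlgClosed k] [CharZero k] {n : ℕ}
    (g : GL (Fin n) k) :
    ∃ (Q : GL (Fin n) k) (d : Fin n → kˣ) (Y : Matrix (Fin n) (Fin n) k), IsNilpotent Y ∧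
      (g : Matrix (Fin n) (Fin n) k) = (Q * diagGL d * Q⁻¹ : GL (Fin n) k) * IsNilpotent.exp Y ∧
      Commute ((Q * diagGL d * Q⁻¹ : GL (Fin n) k) : Matrix (Fin n) (Fin n) k) Y := by
  obtain ⟨Q, d, N, hN, hg, hc⟩ := exists_jordan_add (g : Matrix (Fin n) (Fin n) k)
  set s : Matrix (Fin n) (Fin n) k := Q * Matrix.diagonal d * (Q⁻¹ : GL (Fin n) k) with hs
  have hsu : IsUnit s := by
    have : s = g - N := by rw [hg]; abel
    rw [this, sub_eq_add_neg]
    refine IsNilpotent.isUnit_add_left_of_commute hN.neg g.isUnit ?_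
    rw [hg]
    exact ((Commute.refl N).add_right hc).neg_left
  have hdu : IsUnit (Matrix.diagonal d) := by
    have : Matrix.diagonal d = (Q⁻¹ : GL (Fin n) k) * s * Q := by
      rw [hs]; simp [mul_assoc]
    rw [this]
    exact ((Q⁻¹).isUnit.mul hsu).mul Q.isUnit
  have hd0 := isUnit_diag d hdu
  let d' : Fin n → kˣ := fun i => Units.mk0 (d i) (hd0 i)
  let S : GL (Fin n) k := Q * diagGL d' * Q⁻¹
  have hS : (S : Matrix (Fin n) (Fin n) k) = s := by
    simp only [S, hs, Units.val_mul, diagGL_val]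
    rfl
  have hc' : Commute (S : Matrix (Fin n) (Fin n) k) N := by rw [hS]; exact hc.symm
  have hc2 : Commute ((S⁻¹ : GL (Fin n) k) : Matrix (Fin n) (Fin n) k) N :=
    hc'.units_inv_left
  set M := ((S⁻¹ : GL (Fin n) k) : Matrix (Fin n) (Fin n) k) * N with hM
  have hMn : IsNilpotent M := hc2.isNilpotent_mul_left hN
  have hSM : Commute (S : Matrix (Fin n) (Fin n) k) M := by
    refine Commute.mul_right ?_ hc'
    exact ((Commute.refl S).inv_right).map (Units.coeHom (Matrix (Fin n) (Fin n) k))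
  obtain ⟨m, hm⟩ := hMn
  obtain ⟨l, hl, hexp⟩ := exists_log (k := k) m
  refine ⟨Q, d', aeval M l, ?_, ?_, ?_⟩
  · obtain ⟨l', rfl⟩ := hl
    refine ⟨m, ?_⟩
    rw [← map_pow, mul_pow, map_mul, map_pow, aeval_X, hm, zero_mul]
  · rw [hexp _ M hm, mul_add, mul_one]
    change _ = (S : Matrix (Fin n) (Fin n) k) + S * M
    rw [hM, ← mul_assoc, ← Units.val_mul, mul_inv_cancel, Units.val_one, one_mul, hS, add_comm]
    exact hg
  · change Commute (S : Matrix (Fin n) (Fin n) k) _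
    exact Algebra.commute_of_mem_adjoin_singleton_of_commute (aeval_mem_adjoin_singleton k M) hSM



/-- shift operator on sequences -/
def shiftEnd (k : Type) [Field k] : Module.End k (ℕ → k) :=
  LinearMap.funLeft k k (fun m => m + 1)

lemma shift_iter {k : Type} [Field k] (c : k) (j : ℕ) : ∀ h : k → k,
    ((shiftEnd k - c • (1 : Module.End k (ℕ → k))) ^ j) (fun m : ℕ => h m * c ^ m) =
      fun m : ℕ => c ^ j * ((fwdDiff (1 : k))^[j] h) m * c ^ m := by
  induction j with
  | zero => intro h; simp
  | succ j ih =>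
    intro h
    rw [pow_succ', Module.End.mul_apply, ih, Function.iterate_succ_apply']
    funext m
    simp [shiftEnd, LinearMap.funLeft_apply, fwdDiff]
    ring

lemma exp_poly_mem {k : Type} [Field k] (c : k) (p : k[X]) :
    (fun m : ℕ => p.eval (m : k) * c ^ m) ∈ (shiftEnd k).maxGenEigenspace c := by
  rw [Module.End.mem_maxGenEigenspace]
  refine ⟨p.natDegree + 1, ?_⟩
  rw [shift_iter c _ (fun x => p.eval x)]
  have := Polynomial.fwdDiff_iter_degree_add_one_eq_zero p
  funext m
  have h2 := congrFun this (m : k)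
  simp only [Pi.zero_apply] at h2 ⊢
  rw [h2]; ring

lemma poly_eq_zero_of_nat {k : Type} [Field k] [CharZero k] (p : k[X])
    (h : ∀ m : ℕ, p.eval (m : k) = 0) : p = 0 := by
  refine Polynomial.eq_zero_of_infinite_isRoot p ?_
  refine Set.Infinite.mono (s := Set.range (fun m : ℕ => (m : k))) ?_ ?_
  · rintro _ ⟨m, rfl⟩; exact h m
  · exact Set.infinite_range_of_injective Nat.cast_injective

/-- evaluation on exponential polynomials -/
noncomputable def evE {k : Type} [Field k] {Γ : Subgroup kˣ} (θ : Γ →* k) (b : k) :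
    MonoidAlgebra k[X] Γ →ₐ[k] k :=
  MonoidAlgebra.liftNCAlgHom (Polynomial.aeval b) θ (fun _ _ => Commute.all _ _)

lemma evE_single {k : Type} [Field k] {Γ : Subgroup kˣ} (θ : Γ →* k) (b : k) (γ : Γ) (p : k[X]) :
    evE θ b (MonoidAlgebra.single γ p) = p.eval b * θ γ := by
  simp [evE, MonoidAlgebra.liftNC_single]

/-- the standard character -/
def stdChar {k : Type} [Field k] (Γ : Subgroup kˣ) : Γ →* k :=
  (Units.coeHom k).comp Γ.subtype

lemma evE_injective {k : Type} [Field k] [CharZero k] {Γ : Subgroup kˣ}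
    (r : MonoidAlgebra k[X] Γ) (h : ∀ m : ℕ, evE (stdChar Γ ^ m) (m : k) r = 0) : r = 0 := by
  classical
  have hind : iSupIndep (fun γ : Γ => (shiftEnd k).maxGenEigenspace (stdChar Γ γ)) :=
    (Module.End.independent_maxGenEigenspace (shiftEnd k)).comp
      (f := fun γ : Γ => stdChar Γ γ) (fun a b hab => Subtype.ext (Units.ext hab))
  rw [iSupIndep_iff_finsetSum_eq_zero_imp_eq_zero] at hind
  have hsum : ∀ m : ℕ, evE (stdChar Γ ^ m) (m : k) r =
      ∑ γ ∈ r.coeff.support, (r.coeff γ).eval (m : k) * (stdChar Γ γ) ^ m := by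
    intro m
    conv_lhs => rw [← MonoidAlgebra.sum_coeff_single r]
    rw [Finsupp.sum, map_sum]
    refine Finset.sum_congr rfl fun γ _ => ?_
    rw [evE_single]; rfl
  have h0 := hind r.coeff.support
    (fun γ => (fun m : ℕ => (r.coeff γ).eval (m : k) * (stdChar Γ γ) ^ m))
    (fun γ _ => exp_poly_mem _ _)
    (by
      funext m
      rw [Finset.sum_apply, ← hsum, h]; rfl)
  refine MonoidAlgebra.ext (Finsupp.ext fun γ => ?_)
  by_contra hne
  have hγ : γ ∈ r.coeff.support := by simpa using hne
  refine hne ?_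
  rw [poly_eq_zero_of_nat (r.coeff γ)]
  · rfl
  intro m
  have := congrFun (h0 γ hγ) m
  simp only [Pi.zero_apply, mul_eq_zero] at this
  refine this.resolve_right (pow_ne_zero _ ?_)
  exact Units.ne_zero _

lemma exists_hom_int {A : Type} [CommGroup A] (hfg : Group.FG A) (a : A)
    (ha : ∀ n : ℕ, 0 < n → a ^ n ≠ 1) :
    ∃ e : A →* Multiplicative ℤ, 0 < (e a).toAdd := by
  have h1 : Module.Finite ℤ (Additive A) := by
    rw [Module.Finite.iff_addGroup_fg]
    exact GroupFG.iff_add_fg.1 hfg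
  let M := Additive A ⧸ Submodule.torsion ℤ (Additive A)
  have : Module.Free ℤ M := inferInstance
  let b := Module.Free.chooseBasis ℤ M
  let x : M := Submodule.Quotient.mk (Additive.ofMul a)
  have hx : x ≠ 0 := by
    intro h
    rw [Submodule.Quotient.mk_eq_zero, Submodule.mem_torsion_iff] at h
    obtain ⟨c, hc⟩ := h
    have hc0 : (c : ℤ) ≠ 0 := nonZeroDivisors.ne_zero c.2
    have hc' : a ^ (c : ℤ) = 1 := by
      exact congrArg Additive.toMul hc
    have h3 : a ^ (c : ℤ).natAbs = 1 := by
      rcases Int.natAbs_eq (c : ℤ) with h | h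
      · rw [← zpow_natCast, ← h, hc']
      · rw [← zpow_natCast, ← inv_inj, ← zpow_neg, ← h, hc']; simp
    exact ha _ (Int.natAbs_pos.2 hc0) h3
  have : ∃ i, b.repr x i ≠ 0 := by
    by_contra! h
    exact hx (b.repr.map_eq_zero_iff.1 (Finsupp.ext h))
  obtain ⟨i, hi⟩ := this
  let e0 : Additive A →+ ℤ := ((b.coord i).comp (Submodule.mkQ _)).toAddMonoidHom
  have he0 : e0 (Additive.ofMul a) = b.repr x i := rfl
  rcases lt_or_gt_of_ne hi with h | h
  · refine ⟨AddMonoidHom.toMultiplicativeRight (-e0), ?_⟩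
    change 0 < - e0 (Additive.ofMul a)
    rw [he0]; omega
  · refine ⟨AddMonoidHom.toMultiplicativeRight e0, ?_⟩
    change 0 < e0 (Additive.ofMul a)
    rw [he0]; omega


/-- base change of an invertible matrix along a `k`-algebra homomorphism -/
def mp {k R : Type} [Field k] [CommRing R] [Algebra k R] {n : ℕ} (ε : R →ₐ[k] k) :
    GL (Fin n) R →* GL (Fin n) k :=
  Matrix.GeneralLinearGroup.map (ε : R →+* k)

lemma mp_apply {k R : Type} [Field k] [CommRing R] [Algebra k R] {n : ℕ} (ε : R →ₐ[k] k)
    (g : GL (Fin n) R) (i j : Fin n) :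
    (mp ε g : Matrix (Fin n) (Fin n) k) i j = ε ((g : Matrix (Fin n) (Fin n) R) i j) := rfl

lemma mp_val {k R : Type} [Field k] [CommRing R] [Algebra k R] {n : ℕ} (ε : R →ₐ[k] k)
    (g : GL (Fin n) R) :
    (mp ε g : Matrix (Fin n) (Fin n) k) = ε.mapMatrix (g : Matrix (Fin n) (Fin n) R) := rfl

/-- constant matrices -/
def cst {k : Type} [Field k] (R : Type) [CommRing R] [Algebra k R] {n : ℕ} :
    GL (Fin n) k →* GL (Fin n) R :=
  Matrix.GeneralLinearGroup.map (algebraMap k R)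

lemma mp_cst {k R : Type} [Field k] [CommRing R] [Algebra k R] {n : ℕ} (ε : R →ₐ[k] k)
    (g : GL (Fin n) k) : mp ε (cst R g) = g := by
  apply Matrix.GeneralLinearGroup.ext
  intro i j
  rw [mp_apply]
  exact ε.commutes _

lemma mem_of_jointly {k R : Type} [Field k] [CommRing R] [Algebra k R] (G : AlgGroup k)
    (gh : GL (Fin G.n) R) {ι : Type} (ε : ι → R →ₐ[k] k)
    (hinj : ∀ r : R, (∀ i, ε i r = 0) → r = 0) (h : ∀ i, mp (ε i) gh ∈ G.toSubgroup)
    (ε' : R →ₐ[k] k) : mp ε' gh ∈ G.toSubgroup := by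
  obtain ⟨I, hI⟩ := G.closed
  have key : ∀ (e : R →ₐ[k] k) (f : MvPolynomial (Fin G.n × Fin G.n) k),
      MvPolynomial.eval (mat2pt (mp e gh : Matrix (Fin G.n) (Fin G.n) k)) f =
      e (MvPolynomial.aeval (fun p : Fin G.n × Fin G.n =>
        (gh : Matrix (Fin G.n) (Fin G.n) R) p.1 p.2) f) := by
    intro e f
    rw [← AlgHom.comp_apply, MvPolynomial.comp_aeval, ← MvPolynomial.coe_aeval_eq_eval]
    rfl
  rw [hI]
  intro f hf
  have h0 := hinj (MvPolynomial.aeval (fun p : Fin G.n × Fin G.n =>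
        (gh : Matrix (Fin G.n) (Fin G.n) R) p.1 p.2) f) (fun i => by
    rw [← key]
    exact (hI _).1 (h i) f hf)
  rw [key, h0, map_zero]

lemma phi_ext {k R : Type} [Field k] [CommRing R] [Algebra k R] {G Gq : AlgGroup k}
    (phi : AlgGroupHom G Gq) (gh : GL (Fin G.n) R) :
    ∃ F : Matrix (Fin Gq.n) (Fin Gq.n) R, ∀ e : R →ₐ[k] k, mp e gh ∈ G.toSubgroup →
      (phi.toFun (mp e gh) : Matrix (Fin Gq.n) (Fin Gq.n) k) = e.mapMatrix F := by
  obtain ⟨p, hp⟩ := phi.regular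
  refine ⟨fun i j => MvPolynomial.aeval (Sum.elim
    (fun p : Fin G.n × Fin G.n => (gh : Matrix (Fin G.n) (Fin G.n) R) p.1 p.2)
    (fun _ => ((gh⁻¹ : GL (Fin G.n) R) : Matrix (Fin G.n) (Fin G.n) R).det)) (p (i, j)), ?_⟩
  intro e he
  ext i j
  rw [hp _ he (i, j)]
  change _ = e (MvPolynomial.aeval (Sum.elim
    (fun p : Fin G.n × Fin G.n => (gh : Matrix (Fin G.n) (Fin G.n) R) p.1 p.2)
    (fun _ => ((gh⁻¹ : GL (Fin G.n) R) : Matrix (Fin G.n) (Fin G.n) R).det)) (p (i, j)))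
  rw [← AlgHom.comp_apply, MvPolynomial.comp_aeval, ← MvPolynomial.coe_aeval_eq_eval]
  have : (Sum.elim (mat2pt (mp e gh : Matrix (Fin G.n) (Fin G.n) k))
      (fun _ : Unit => (((mp e gh)⁻¹ : GL (Fin G.n) k) : Matrix (Fin G.n) (Fin G.n) k).det)) =
      fun i => e ((Sum.elim
    (fun p : Fin G.n × Fin G.n => (gh : Matrix (Fin G.n) (Fin G.n) R) p.1 p.2)
    (fun _ => ((gh⁻¹ : GL (Fin G.n) R) : Matrix (Fin G.n) (Fin G.n) R).det)) i) := by
    funext x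
    rcases x with x | x
    · rfl
    · simp only [Sum.elim_inr]
      rw [← map_inv, mp_val, ← AlgHom.map_det]
  rw [this]
  rfl

/-- evaluation of Laurent polynomials -/
noncomputable def evL {k : Type} [Field k] (t : kˣ) : LaurentPolynomial k →ₐ[k] k :=
  { LaurentPolynomial.eval₂ (RingHom.id k) t with
    commutes' := fun r => by
      simp [← LaurentPolynomial.C_eq_algebraMap] }

lemma evL_T {k : Type} [Field k] (t : kˣ) (n : ℤ) :
    evL t (LaurentPolynomial.T n) = ((t ^ n : kˣ) : k) :=
  LaurentPolynomial.eval₂_T _ _ _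

lemma evL_toLaurent {k : Type} [Field k] (t : kˣ) (p : k[X]) :
    evL t (toLaurent p) = p.eval (t : k) :=
  LaurentPolynomial.eval₂_toLaurent _ _ _

lemma poly_eq_zero_of_units {k : Type} [Field k] [Infinite k] (p : k[X])
    (h : ∀ t : kˣ, p.eval (t : k) = 0) : p = 0 := by
  refine Polynomial.eq_zero_of_infinite_isRoot p ?_
  refine Set.Infinite.mono (s := {0}ᶜ) ?_ (Set.finite_singleton (0 : k)).infinite_compl
  intro t ht
  exact h (Units.mk0 t ht)

lemma poly_eq_of_units {k : Type} [Field k] [Infinite k] (p q : k[X])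
    (h : ∀ t : kˣ, p.eval (t : k) = q.eval (t : k)) : p = q := by
  rw [← sub_eq_zero]
  exact poly_eq_zero_of_units _ fun t => by rw [eval_sub, h, sub_self]

lemma evL_injective {k : Type} [Field k] [Infinite k] (f : LaurentPolynomial k)
    (h : ∀ t : kˣ, evL t f = 0) : f = 0 := by
  obtain ⟨n, p, hp⟩ := LaurentPolynomial.exists_T_pow f
  have hp0 : p = 0 := by
    refine poly_eq_zero_of_units p fun t => ?_
    rw [← evL_toLaurent, hp, map_mul, h, zero_mul]
  rw [hp0, map_zero] at hp
  exact ((LaurentPolynomial.isUnit_T (n : ℤ)).mul_left_eq_zero).1 hp.symm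

lemma evL_to_mv {k : Type} [Field k] (f : LaurentPolynomial k) :
    ∃ p : MvPolynomial Bool k, ∀ t : kˣ,
      evL t f = MvPolynomial.eval (fun b => if b then (t : k) else ((t⁻¹ : kˣ) : k)) p := by
  obtain ⟨n, p, hp⟩ := LaurentPolynomial.exists_T_pow f
  refine ⟨aeval (MvPolynomial.X true) p * MvPolynomial.X false ^ n, fun t => ?_⟩
  have h1 : evL t f = p.eval (t : k) * ((t⁻¹ : kˣ) : k) ^ n := by
    rw [← evL_toLaurent, hp, map_mul, evL_T, mul_assoc, ← Units.val_pow_eq_pow_val,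
      ← Units.val_mul]
    simp
  have h2 : ∀ x : Bool → k, MvPolynomial.eval x (aeval (MvPolynomial.X true) p) = p.eval (x true) := by
    intro x
    rw [← MvPolynomial.coe_aeval_eq_eval, RingHom.coe_coe, ← Polynomial.aeval_algHom_apply]
    simp
  rw [h1, map_mul, map_pow, h2]
  simp

lemma mv_to_evL {k : Type} [Field k] (p : MvPolynomial Bool k) :
    ∃ f : LaurentPolynomial k, ∀ t : kˣ,
      evL t f = MvPolynomial.eval (fun b => if b then (t : k) else ((t⁻¹ : kˣ) : k)) p := by
  refine ⟨MvPolynomial.aeval (fun b => if b then LaurentPolynomial.T 1 else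
    LaurentPolynomial.T (-1)) p, fun t => ?_⟩
  rw [← AlgHom.comp_apply, MvPolynomial.comp_aeval, ← MvPolynomial.coe_aeval_eq_eval]
  have : (fun i : Bool => evL t (if i then LaurentPolynomial.T 1 else LaurentPolynomial.T (-1))) =
    fun b : Bool => if b then (t : k) else ((t⁻¹ : kˣ) : k) := by
    funext b
    cases b <;> simp [evL_T]
  rw [this]
  rfl

lemma exists_hat {k : Type} [Field k] [Infinite k] {G : AlgGroup k} (lam : OnePS G) :
    ∃ lh : GL (Fin G.n) (LaurentPolynomial k), ∀ t, mp (evL t) lh = lam.toFun t := by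
  obtain ⟨p, hp⟩ := lam.regular
  choose f hf using fun ij => mv_to_evL (p ij)
  have hinv : ∀ p : MvPolynomial Bool k, ∃ f : LaurentPolynomial k, ∀ t : kˣ,
      evL t f = MvPolynomial.eval (fun b => if b then ((t⁻¹ : kˣ) : k) else (t : k)) p := by
    intro p
    obtain ⟨f, hf⟩ := mv_to_evL (MvPolynomial.rename Bool.not p)
    refine ⟨f, fun t => ?_⟩
    rw [hf, MvPolynomial.eval_rename]
    congr 2
    funext b
    cases b <;> simp
  choose f' hf' using fun ij => hinv (p ij)
  let M : Matrix (Fin G.n) (Fin G.n) (LaurentPolynomial k) := fun i j => f (i, j)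
  let M' : Matrix (Fin G.n) (Fin G.n) (LaurentPolynomial k) := fun i j => f' (i, j)
  have hM : ∀ t, (evL t).mapMatrix M = lam.toFun t := by
    intro t
    ext i j
    rw [hp t (i, j)]
    exact hf (i, j) t
  have hM' : ∀ t, (evL t).mapMatrix M' = ((lam.toFun t)⁻¹ : GL (Fin G.n) k) := by
    intro t
    rw [← map_inv]
    ext i j
    rw [hp t⁻¹ (i, j), inv_inv]
    exact hf' (i, j) t
  have hext : ∀ A B : Matrix (Fin G.n) (Fin G.n) (LaurentPolynomial k),
      (∀ t, (evL t).mapMatrix A = (evL t).mapMatrix B) → A = B := by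
    intro A B h
    ext1 i j
    rw [← sub_eq_zero]
    refine evL_injective _ fun t => ?_
    have := congrFun (congrFun (h t) i) j
    simp only [AlgHom.mapMatrix_apply, Matrix.map_apply] at this
    rw [map_sub, this, sub_self]
  refine ⟨⟨M, M', ?_, ?_⟩, fun t => Units.ext (hM t)⟩
  · refine hext _ _ fun t => ?_
    rw [map_mul, hM, hM', map_one, ← Units.val_mul, mul_inv_cancel, Units.val_one]
  · refine hext _ _ fun t => ?_
    rw [map_mul, hM, hM', map_one, ← Units.val_mul, inv_mul_cancel, Units.val_one]

lemma mp_regular {k : Type} [Field k] {n : ℕ} (f : kˣ → Matrix (Fin n) (Fin n) k)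
    (M : Matrix (Fin n) (Fin n) (LaurentPolynomial k)) (h : ∀ t, f t = (evL t).mapMatrix M) :
    ∃ p : Fin n × Fin n → MvPolynomial Bool k,
    ∀ (t : kˣ) (ij : Fin n × Fin n), f t ij.1 ij.2 =
        MvPolynomial.eval (fun b => if b then (t : k) else ((t⁻¹ : kˣ) : k)) (p ij) := by
  choose p hp using fun ij : Fin n × Fin n => evL_to_mv (M ij.1 ij.2)
  refine ⟨p, fun t ij => ?_⟩
  rw [← hp, h]
  rfl

lemma comp_regular {k : Type} [Field k] [Infinite k] {G Gq : AlgGroup k} (phi : AlgGroupHom G Gq)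
    (lam : OnePS G) : ∃ p : Fin Gq.n × Fin Gq.n → MvPolynomial Bool k,
    ∀ (t : kˣ) (ij : Fin Gq.n × Fin Gq.n),
      (phi.toFun (lam.toFun t) : Matrix (Fin Gq.n) (Fin Gq.n) k) ij.1 ij.2 =
        MvPolynomial.eval (fun b => if b then (t : k) else ((t⁻¹ : kˣ) : k)) (p ij) := by
  obtain ⟨lh, hlh⟩ := exists_hat lam
  obtain ⟨F, hF⟩ := phi_ext phi lh
  refine mp_regular (fun t => (phi.toFun (lam.toFun t) : Matrix (Fin Gq.n) (Fin Gq.n) k)) F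
    fun t => ?_
  have := hF (evL t)
  rw [hlh] at this
  exact this (lam.mem t)

/-- the composite of a one-parameter subgroup with a morphism -/
def compPS {k : Type} [Field k] [Infinite k] {G Gq : AlgGroup k} (phi : AlgGroupHom G Gq)
    (lam : OnePS G) : OnePS Gq where
  toFun :=
    { toFun := fun t => phi.toFun (lam.toFun t)
      map_one' := by rw [map_one, phi.map_one]
      map_mul' := fun s t => by rw [map_mul, phi.map_mul _ (lam.mem s) _ (lam.mem t)] }
  mem := fun t => phi.mem _ (lam.mem t)
  regular := comp_regular phi lam

lemma compPS_apply {k : Type} [Field k] [Infinite k] {G Gq : AlgGroup k} (phi : AlgGroupHom G Gq)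
    (lam : OnePS G) (t : kˣ) : (compPS phi lam).toFun t = phi.toFun (lam.toFun t) := rfl

lemma phi_inv {k : Type} [Field k] {G Gq : AlgGroup k} (phi : AlgGroupHom G Gq)
    {g : GL (Fin G.n) k} (hg : g ∈ G.toSubgroup) : phi.toFun g⁻¹ = (phi.toFun g)⁻¹ := by
  rw [eq_inv_iff_mul_eq_one, ← phi.map_mul _ (inv_mem hg) _ hg, inv_mul_cancel, phi.map_one]

lemma phi_pow {k : Type} [Field k] {G Gq : AlgGroup k} (phi : AlgGroupHom G Gq)
    {g : GL (Fin G.n) k} (hg : g ∈ G.toSubgroup) (m : ℕ) :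
    phi.toFun (g ^ m) = (phi.toFun g) ^ m := by
  induction m with
  | zero => simp [phi.map_one]
  | succ m ih => rw [pow_succ, pow_succ, phi.map_mul _ (pow_mem hg m) _ hg, ih]


/-- evaluation of polynomials -/
noncomputable def evP {k : Type} [Field k] (t : k) : k[X] →ₐ[k] k := aeval t

lemma evP_apply {k : Type} [Field k] (t : k) (p : k[X]) : evP t p = p.eval t := by
  simp [evP]

/-- constant matrices -/
def cstM {k : Type} [Field k] (R : Type) [CommRing R] [Algebra k R] {n : ℕ} :
    Matrix (Fin n) (Fin n) k →ₐ[k] Matrix (Fin n) (Fin n) R :=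
  (Algebra.ofId k R).mapMatrix

lemma map_cstM {k R : Type} [Field k] [CommRing R] [Algebra k R] {n : ℕ} (e : R →ₐ[k] k)
    (M : Matrix (Fin n) (Fin n) k) : e.mapMatrix (cstM R M) = M := by
  ext i j
  exact e.commutes _

lemma cst_val {k R : Type} [Field k] [CommRing R] [Algebra k R] {n : ℕ}
    (g : GL (Fin n) k) : (cst R g : Matrix (Fin n) (Fin n) R) = cstM R (g : Matrix _ _ k) := rfl

lemma mat_ext {k R ι : Type} [Field k] [CommRing R] [Algebra k R] {n : ℕ} (ε : ι → R →ₐ[k] k)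
    (hinj : ∀ r : R, (∀ i, ε i r = 0) → r = 0) (A B : Matrix (Fin n) (Fin n) R)
    (h : ∀ i, (ε i).mapMatrix A = (ε i).mapMatrix B) : A = B := by
  ext1 i j
  rw [← sub_eq_zero]
  refine hinj _ fun t => ?_
  have := congrFun (congrFun (h t) i) j
  simp only [AlgHom.mapMatrix_apply, Matrix.map_apply] at this
  rw [map_sub, this, sub_self]

lemma evP_inj {k : Type} [Field k] [Infinite k] (p : k[X])
    (h : ∀ t : kˣ, evP (t : k) p = 0) : p = 0 :=
  poly_eq_zero_of_units p fun t => by rw [← evP_apply, h]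

lemma matP_ext {k : Type} [Field k] [Infinite k] {n : ℕ} (A B : Matrix (Fin n) (Fin n) k[X])
    (h : ∀ t : kˣ, (evP (t : k)).mapMatrix A = (evP (t : k)).mapMatrix B) : A = B :=
  mat_ext (fun t : kˣ => evP (t : k)) evP_inj A B h

lemma exists_gl {k : Type} [Field k] [Infinite k] {n : ℕ} (q : Matrix (Fin n) (Fin n) k[X])
    (c : kˣ) (h : ∀ t : kˣ, ((evP (t : k)).mapMatrix q).det = c) :
    ∃ qh : GL (Fin n) k[X], (qh : Matrix (Fin n) (Fin n) k[X]) = q := by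
  have hdet : q.det = C (c : k) := by
    refine poly_eq_of_units _ _ fun t => ?_
    rw [← evP_apply, AlgHom.map_det, h, eval_C]
  have hu : IsUnit q := by
    rw [Matrix.isUnit_iff_isUnit_det, hdet]
    exact (c.isUnit).map C
  exact hu

/-- rescaling the variable -/
noncomputable def sc {k : Type} [Field k] (s : k) : k[X] →ₐ[k] k[X] := aeval (C s * X)

lemma evP_sc {k : Type} [Field k] (s t : k) : (evP t).comp (sc s) = evP (s * t) := by
  ext
  simp [evP, sc]

lemma mapMatrix_comp_apply {k R S T : Type} [Field k] [CommRing R] [Algebra k R] [CommRing S]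
    [Algebra k S] [CommRing T] [Algebra k T] {n : ℕ} (f : S →ₐ[k] T) (g : R →ₐ[k] S)
    (M : Matrix (Fin n) (Fin n) R) :
    f.mapMatrix (g.mapMatrix M) = (f.comp g).mapMatrix M := rfl

lemma limit_weight {k : Type} [Field k] [Infinite k] {G : AlgGroup k} (lam : OnePS G)
    (Y : Matrix (Fin G.n) (Fin G.n) k) (d : ℕ) (q : Matrix (Fin G.n) (Fin G.n) k[X])
    (h : ∀ t : kˣ, (evP (t : k)).mapMatrix q =
      (t : k) ^ d • ((lam.toFun t : Matrix _ _ k) * Y *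
        (((lam.toFun t)⁻¹ : GL (Fin G.n) k) : Matrix _ _ k)))
    (s : kˣ) :
    (s : k) ^ d • ((lam.toFun s : Matrix _ _ k) * (evP 0).mapMatrix q *
      (((lam.toFun s)⁻¹ : GL (Fin G.n) k) : Matrix _ _ k)) = (evP 0).mapMatrix q := by
  have key : (sc (s : k)).mapMatrix q = (s : k) ^ d • (cstM k[X] (lam.toFun s : Matrix _ _ k) * q *
      cstM k[X] (((lam.toFun s)⁻¹ : GL (Fin G.n) k) : Matrix _ _ k)) := by
    refine matP_ext _ _ fun t => ?_
    rw [mapMatrix_comp_apply, evP_sc, ← Units.val_mul, h, map_mul lam.toFun, mul_inv_rev, map_smul, map_mul,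
      map_mul, map_cstM, map_cstM, h]
    simp only [Units.val_mul, mul_pow, Matrix.mul_smul, Matrix.smul_mul, smul_smul, mul_assoc]
  have := congrArg (evP 0).mapMatrix key
  rw [mapMatrix_comp_apply, evP_sc, mul_zero, map_smul, map_mul, map_mul, map_cstM,
      map_cstM] at this
  exact this.symm

lemma mem_Pset_of {k : Type} [Field k] [Infinite k] {G : AlgGroup k} (lam : OnePS G)
    {g : GL (Fin G.n) k} (hg : g ∈ G.toSubgroup) (q : Matrix (Fin G.n) (Fin G.n) k[X])
    (h : ∀ t : kˣ, (evP (t : k)).mapMatrix q =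
      (lam.toFun t * g * (lam.toFun t)⁻¹ : GL (Fin G.n) k)) :
    ∃ qh : GL (Fin G.n) k[X], (∀ t : kˣ, mp (evP (t : k)) qh = lam.toFun t * g * (lam.toFun t)⁻¹) ∧
      mp (evP 0) qh ∈ G.toSubgroup ∧ GLimit lam g (mp (evP 0) qh) ∧
      ∀ s, lam.toFun s * mp (evP 0) qh = mp (evP 0) qh * lam.toFun s := by
  obtain ⟨qh, rfl⟩ := exists_gl q (Matrix.GeneralLinearGroup.det g) (fun t => by
    rw [h]
    simp only [Units.val_mul, Matrix.det_mul]
    rw [mul_right_comm, ← Matrix.det_mul, ← Units.val_mul, mul_inv_cancel, Units.val_one,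
      Matrix.det_one, one_mul]
    rfl)
  have h1 : ∀ t : kˣ, mp (evP (t : k)) qh = lam.toFun t * g * (lam.toFun t)⁻¹ := 
    fun t => Units.ext (h t)
  have h0 : mp (evP 0) qh ∈ G.toSubgroup := by
    refine mem_of_jointly G qh (fun t : kˣ => evP (t : k)) evP_inj (fun t => ?_) _
    rw [h1]
    exact mul_mem (mul_mem (lam.mem t) hg) (inv_mem (lam.mem t))
  refine ⟨qh, h1, h0, ⟨h0, fun ij => (qh : Matrix _ _ k[X]) ij.1 ij.2, ?_, ?_⟩, ?_⟩
  · intro t ij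
    rw [← evP_apply, ← h1]
    rfl
  · intro ij
    rw [← evP_apply]
    rfl
  · intro s
    have := limit_weight lam g 0 qh (fun t => by rw [h, pow_zero, one_smul]; rfl) s
    rw [pow_zero, one_smul] at this
    rw [← mul_inv_eq_iff_eq_mul]
    exact Units.ext this

lemma Pset_elim {k : Type} [Field k] {G : AlgGroup k} (lam : OnePS G)
    {g h : GL (Fin G.n) k} (hgh : GLimit lam g h) : ∃ q : Matrix (Fin G.n) (Fin G.n) k[X],
    (∀ t : kˣ, (evP (t : k)).mapMatrix q =
      (lam.toFun t * g * (lam.toFun t)⁻¹ : GL (Fin G.n) k)) ∧ (evP 0).mapMatrix q = h := by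
  obtain ⟨h0, q, h1, h2⟩ := hgh
  refine ⟨fun i j => q (i, j), fun t => ?_, ?_⟩
  · ext i j
    rw [h1 t (i, j), ← evP_apply]
    rfl
  · ext i j
    rw [h2 (i, j), ← evP_apply]
    rfl

lemma mem_Pset_iff {k : Type} [Field k] [Infinite k] {G : AlgGroup k} (lam : OnePS G)
    {g : GL (Fin G.n) k} : g ∈ Pset lam ↔ g ∈ G.toSubgroup ∧ ∃ q : Matrix (Fin G.n) (Fin G.n) k[X],
    ∀ t : kˣ, (evP (t : k)).mapMatrix q =
      (lam.toFun t * g * (lam.toFun t)⁻¹ : GL (Fin G.n) k) := by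
  constructor
  · rintro ⟨h1, h, h2⟩
    obtain ⟨q, hq, -⟩ := Pset_elim lam h2
    exact ⟨h1, q, hq⟩
  · rintro ⟨h1, q, hq⟩
    obtain ⟨qh, -, -, h3, -⟩ := mem_Pset_of lam h1 q hq
    exact ⟨h1, _, h3⟩

lemma mem_Lset_iff {k : Type} [Field k] [Infinite k] {G : AlgGroup k} (lam : OnePS G)
    {g : GL (Fin G.n) k} : g ∈ Lset lam ↔ g ∈ G.toSubgroup ∧
      ∀ s, lam.toFun s * g = g * lam.toFun s := by
  constructor
  · rintro ⟨h1, h2⟩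
    obtain ⟨q, hq, h0⟩ := Pset_elim lam h2
    refine ⟨h1, fun s => ?_⟩
    obtain ⟨qh, hqh, -, -, h3⟩ := mem_Pset_of lam h1 q hq
    have : (qh : Matrix _ _ k[X]) = q := matP_ext _ _ fun t => by
      rw [hq, ← hqh]
      rfl
    have e : mp (evP 0) qh = g := Units.ext (by rw [mp_val, this, h0])
    rw [e] at h3
    exact h3 s
  · rintro ⟨h1, h2⟩
    refine ⟨h1, h1, fun ij => C ((g : Matrix _ _ k) ij.1 ij.2), ?_, ?_⟩
    · intro t ij
      rw [h2 t, mul_inv_cancel_right, eval_C]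
    · intro ij
      rw [eval_C]

lemma Lset_sub_Pset {k : Type} [Field k] {G : AlgGroup k} (lam : OnePS G) :
    Lset lam ⊆ Pset lam := fun g hg => ⟨hg.1, g, hg.2⟩

lemma Pset_mul {k : Type} [Field k] [Infinite k] {G : AlgGroup k} (lam : OnePS G)
    {g h : GL (Fin G.n) k} (hg : g ∈ Pset lam) (hh : h ∈ Pset lam) : g * h ∈ Pset lam := by
  rw [mem_Pset_iff] at *
  obtain ⟨h1, q, hq⟩ := hg
  obtain ⟨h2, r, hr⟩ := hh
  refine ⟨mul_mem h1 h2, q * r, fun t => ?_⟩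
  rw [map_mul, hq, hr, ← Units.val_mul]
  congr 1
  group

lemma Pset_map {k : Type} [Field k] [Infinite k] {G Gq : AlgGroup k} (phi : AlgGroupHom G Gq)
    (lam : OnePS G) {g : GL (Fin G.n) k} (hg : g ∈ Pset lam) :
    phi.toFun g ∈ Pset (compPS phi lam) := by
  rw [mem_Pset_iff] at *
  obtain ⟨h1, q, hq⟩ := hg
  obtain ⟨qh, h2, -⟩ := mem_Pset_of lam h1 q hq
  obtain ⟨F, hF⟩ := phi_ext phi qh
  refine ⟨phi.mem _ h1, F, fun t => ?_⟩
  have hm := mul_mem (lam.mem t) h1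
  have hi := inv_mem (lam.mem t)
  rw [← hF, h2, compPS_apply, phi.map_mul _ hm _ hi, phi.map_mul _ (lam.mem t) _ h1,
    phi_inv phi (lam.mem t)]
  rw [h2]
  exact mul_mem hm hi

lemma Lset_map {k : Type} [Field k] [Infinite k] {G Gq : AlgGroup k} (phi : AlgGroupHom G Gq)
    (lam : OnePS G) {g : GL (Fin G.n) k} (hg : g ∈ Lset lam) :
    phi.toFun g ∈ Lset (compPS phi lam) := by
  rw [mem_Lset_iff] at *
  refine ⟨phi.mem _ hg.1, fun s => ?_⟩
  rw [compPS_apply, ← phi.map_mul _ (lam.mem s) _ hg.1, hg.2, phi.map_mul _ hg.1 _ (lam.mem s)]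


lemma exists_clear {k : Type} [Field k] {n : ℕ}
    (M : Matrix (Fin n) (Fin n) (LaurentPolynomial k)) :
    ∃ (D : ℕ) (A : Matrix (Fin n) (Fin n) k[X]), ∀ t : kˣ,
      (evP (t : k)).mapMatrix A = (t : k) ^ D • (evL t).mapMatrix M := by
  choose N p hp using fun ij : Fin n × Fin n => LaurentPolynomial.exists_T_pow (M ij.1 ij.2)
  refine ⟨∑ ij, N ij, Matrix.of fun i j => X ^ (∑ ij, N ij - N (i, j)) * p (i, j), fun t => ?_⟩
  ext i j
  have h1 := congrArg (evL t) (hp (i, j))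
  rw [evL_toLaurent, map_mul, evL_T] at h1
  have hle : N (i, j) ≤ ∑ ij, N ij :=
    Finset.single_le_sum (f := N) (fun _ _ => Nat.zero_le _) (Finset.mem_univ (i, j))
  simp only [AlgHom.mapMatrix_apply, Matrix.map_apply, Matrix.of_apply, Matrix.smul_apply,
    evP_apply, eval_mul, eval_pow, eval_X, h1, smul_eq_mul]
  rw [zpow_natCast, Units.val_pow_eq_pow_val, mul_left_comm, ← pow_add, Nat.sub_add_cancel hle,
    mul_comm]

lemma natDegree_mat_mul {k : Type} [Field k] {n : ℕ} (A B : Matrix (Fin n) (Fin n) k[X]) (a b : ℕ)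
    (hA : ∀ i j, (A i j).natDegree ≤ a) (hB : ∀ i j, (B i j).natDegree ≤ b) (i j : Fin n) :
    ((A * B) i j).natDegree ≤ a + b := by
  rw [Matrix.mul_apply]
  exact natDegree_sum_le_of_forall_le _ _ fun x _ => natDegree_mul_le_of_le (hA i x) (hB x j)

lemma natDegree_cstM {k : Type} [Field k] {n : ℕ} (M : Matrix (Fin n) (Fin n) k) (i j : Fin n) :
    (cstM k[X] M i j).natDegree ≤ 0 := by
  change (C (M i j)).natDegree ≤ 0
  rw [natDegree_C]

lemma exists_degree_bound {k : Type} [Field k] {n : ℕ} (A : Matrix (Fin n) (Fin n) k[X]) :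
    ∃ a, ∀ i j, (A i j).natDegree ≤ a :=
  ⟨∑ ij : Fin n × Fin n, (A ij.1 ij.2).natDegree, fun i j =>
    Finset.single_le_sum (f := fun ij : Fin n × Fin n => (A ij.1 ij.2).natDegree)
      (fun _ _ => Nat.zero_le _) (Finset.mem_univ (i, j))⟩

lemma monomial_of {k : Type} [Field k] [Infinite k] (p : k[X]) (D E : ℕ) (r : ℕ → k[X])
    (hr : ∀ m, (r m).natDegree ≤ E)
    (h : ∀ (m : ℕ) (t : kˣ), (t : k) ^ D * p.eval ((t : k) ^ m) = (t : k) ^ (D * m) * (r m).eval (t : k)) :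
    p = C (p.coeff D) * X ^ D := by
  have h1 : ∀ m : ℕ, X ^ D * expand k m p = X ^ (D * m) * r m := by
    intro m
    refine poly_eq_of_units _ _ fun t => ?_
    simpa [expand_eval] using h m t
  ext j
  rw [coeff_C_mul_X_pow]
  split_ifs with hj
  · rw [hj]
  · have hm := congrArg (fun q : k[X] => q.coeff (j * (D + E + 1) + D)) (h1 (D + E + 1))
    simp only [coeff_X_pow_mul'] at hm
    rw [if_pos (Nat.le_add_left _ _), Nat.add_sub_cancel,
      coeff_expand_mul (Nat.succ_pos _)] at hm
    rw [hm]
    split_ifs with hle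
    · apply coeff_eq_zero_of_natDegree_lt
      refine lt_of_le_of_lt (hr _) ?_
      rcases lt_or_gt_of_ne hj with h2 | h2
      · exfalso
        have : (j + 1) * (D + E + 1) ≤ D * (D + E + 1) := Nat.mul_le_mul_right _ h2
        rw [add_mul] at this
        omega
      · have : (D + 1) * (D + E + 1) ≤ j * (D + E + 1) := Nat.mul_le_mul_right _ h2
        rw [add_mul] at this
        omega
    · rfl

lemma Lset_of_map {k : Type} [Field k] [Infinite k] {G Gq : AlgGroup k} (phi : AlgGroupHom G Gq)
    (hker : ∀ g ∈ G.toSubgroup, (phi.toFun g = 1 ↔ g ∈ centerSet G))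
    (lam : OnePS G) {g : GL (Fin G.n) k} (hg : g ∈ G.toSubgroup)
    (h : phi.toFun g ∈ Lset (compPS phi lam)) : g ∈ Lset lam := by
  rw [mem_Lset_iff] at *
  refine ⟨hg, ?_⟩
  have h2 := h.2
  let f : kˣ → GL (Fin G.n) k := fun t => lam.toFun t * g * (lam.toFun t)⁻¹ * g⁻¹
  have hfm : ∀ t, f t ∈ G.toSubgroup := fun t =>
    mul_mem (mul_mem (mul_mem (lam.mem t) hg) (inv_mem (lam.mem t))) (inv_mem hg)
  have hfc : ∀ t, f t ∈ centerSet G := by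
    intro t
    rw [← hker _ (hfm t)]
    change phi.toFun (lam.toFun t * g * (lam.toFun t)⁻¹ * g⁻¹) = 1
    rw [phi.map_mul _ (mul_mem (mul_mem (lam.mem t) hg) (inv_mem (lam.mem t))) _ (inv_mem hg),
      phi.map_mul _ (mul_mem (lam.mem t) hg) _ (inv_mem (lam.mem t)),
      phi.map_mul _ (lam.mem t) _ hg, phi_inv phi hg, phi_inv phi (lam.mem t), ← compPS_apply, h2]
    group
  have e1 : ∀ (t : kˣ), lam.toFun t * g * (lam.toFun t)⁻¹ = f t * g := fun t => by
    simp [f]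
  have e2 : ∀ (t : kˣ) (m : ℕ), f t ^ m = lam.toFun t * g ^ m * (lam.toFun t)⁻¹ * (g ^ m)⁻¹ := by
    intro t m
    rw [← conj_pow, e1, (show Commute (f t) g from (hfc t).2 g hg).mul_pow, mul_inv_cancel_right]
  have e3 : ∀ (t : kˣ) (m : ℕ), f (t ^ m) = f t ^ m := by
    intro t m
    have : ∀ m : ℕ, lam.toFun (t ^ m) * g * (lam.toFun (t ^ m))⁻¹ = f t ^ m * g := by
      intro m
      induction m with
      | zero => simp
      | succ m ih =>
        have hc : lam.toFun t * f t ^ m = f t ^ m * lam.toFun t :=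
          ((show Commute (f t) (lam.toFun t) from (hfc t).2 _ (lam.mem t)).pow_left m).symm.eq
        rw [pow_succ' t, map_mul]
        calc _ = lam.toFun t * (lam.toFun (t ^ m) * g * (lam.toFun (t ^ m))⁻¹) * (lam.toFun t)⁻¹ := by
              group
          _ = f t ^ m * (lam.toFun t * g * (lam.toFun t)⁻¹) := by
              rw [ih, ← mul_assoc, hc]; group
          _ = _ := by rw [e1, pow_succ]; exact (mul_assoc _ _ _).symm
    change lam.toFun (t ^ m) * g * (lam.toFun (t ^ m))⁻¹ * g⁻¹ = _
    rw [this, mul_inv_cancel_right]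
  obtain ⟨lh, hlh⟩ := exists_hat lam
  obtain ⟨D1, A, hA⟩ := exists_clear (lh : Matrix (Fin G.n) (Fin G.n) (LaurentPolynomial k))
  obtain ⟨D2, B, hB⟩ := exists_clear
    ((lh⁻¹ : GL (Fin G.n) (LaurentPolynomial k)) : Matrix (Fin G.n) (Fin G.n) (LaurentPolynomial k))
  have hA' : ∀ t : kˣ, (evP (t : k)).mapMatrix A = (t : k) ^ D1 • (lam.toFun t : Matrix _ _ k) := by
    intro t
    rw [hA, ← mp_val, hlh]
  have hB' : ∀ t : kˣ, (evP (t : k)).mapMatrix B =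
      (t : k) ^ D2 • (((lam.toFun t)⁻¹ : GL (Fin G.n) k) : Matrix _ _ k) := by
    intro t
    rw [hB, ← mp_val, map_inv, hlh]
  obtain ⟨a, ha⟩ := exists_degree_bound A
  obtain ⟨b, hb⟩ := exists_degree_bound B
  let r : ℕ → Matrix (Fin G.n) (Fin G.n) k[X] := fun m =>
    A * cstM k[X] ((g ^ m : GL (Fin G.n) k) : Matrix _ _ k) * B *
      cstM k[X] (((g ^ m)⁻¹ : GL (Fin G.n) k) : Matrix _ _ k)
  have hr1 : ∀ m i j, (r m i j).natDegree ≤ a + 0 + b + 0 := fun m =>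
    natDegree_mat_mul _ _ _ _ (natDegree_mat_mul _ _ _ _ (natDegree_mat_mul _ _ _ _ ha
      (natDegree_cstM _)) hb) (natDegree_cstM _)
  have hr2 : ∀ m (t : kˣ), (evP (t : k)).mapMatrix (r m) =
      (t : k) ^ (D1 + D2) • ((f (t ^ m) : GL (Fin G.n) k) : Matrix _ _ k) := by
    intro m t
    simp only [r]
    rw [map_mul, map_mul, map_mul, map_cstM, map_cstM, hA', hB', e3, e2]
    simp only [Units.val_mul, Matrix.mul_smul, Matrix.smul_mul, smul_smul, pow_add]
    rw [mul_comm ((t : k) ^ D1)]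
  have hconst : ∀ t, f t = f 1 := by
    intro t
    ext i j
    have hmono := monomial_of (r 1 i j) (D1 + D2) (a + 0 + b + 0) (fun m => r m i j)
      (fun m => hr1 m i j) (by
        intro m t
        have h3 := congrFun (congrFun (hr2 1 (t ^ m)) i) j
        have h4 := congrFun (congrFun (hr2 m t) i) j
        simp only [AlgHom.mapMatrix_apply, Matrix.map_apply, Matrix.smul_apply, evP_apply,
          smul_eq_mul, pow_one, Units.val_pow_eq_pow_val] at h3 h4
        rw [h3, h4]
        ring)
    have h5 : ∀ t : kˣ, (f t : Matrix _ _ k) i j = (r 1 i j).coeff (D1 + D2) := by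
      intro t
      have h3 := congrFun (congrFun (hr2 1 t) i) j
      simp only [AlgHom.mapMatrix_apply, Matrix.map_apply, Matrix.smul_apply, evP_apply,
          smul_eq_mul, pow_one] at h3
      rw [hmono, eval_mul, eval_C, eval_pow, eval_X, mul_comm] at h3
      exact (mul_left_cancel₀ (pow_ne_zero _ t.ne_zero) h3).symm
    rw [h5, h5]
  intro t
  have h6 := e1 t
  rw [hconst t] at h6
  have h7 : f 1 = 1 := by simp [f]
  rw [h7, one_mul, mul_inv_eq_iff_eq_mul] at h6
  exact h6


lemma conj_clear {k : Type} [Field k] [Infinite k] {G : AlgGroup k} (lam : OnePS G)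
    (Y : Matrix (Fin G.n) (Fin G.n) k) : ∃ (D : ℕ) (A : Matrix (Fin G.n) (Fin G.n) k[X]),
    ∀ t : kˣ, (evP (t : k)).mapMatrix A = (t : k) ^ D • ((lam.toFun t : Matrix _ _ k) * Y *
        (((lam.toFun t)⁻¹ : GL (Fin G.n) k) : Matrix _ _ k)) := by
  obtain ⟨lh, hlh⟩ := exists_hat lam
  obtain ⟨D, A, hA⟩ := exists_clear ((lh : Matrix (Fin G.n) (Fin G.n) (LaurentPolynomial k)) *
    cstM (LaurentPolynomial k) Y *
    ((lh⁻¹ : GL (Fin G.n) (LaurentPolynomial k)) : Matrix (Fin G.n) (Fin G.n) (LaurentPolynomial k)))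
  refine ⟨D, A, fun t => ?_⟩
  rw [hA, map_mul, map_mul, map_cstM, ← mp_val, ← mp_val, map_inv, hlh]

lemma evP_expand {k : Type} [Field k] (N : ℕ) (t : k) :
    (evP t).comp (expand k N) = evP (t ^ N) := by
  ext
  simp [evP]

lemma Pset_pow {k : Type} [Field k] [Infinite k] {G : AlgGroup k} (mu nu : OnePS G) (N : ℕ)
    (hN : 0 < N) (h : ∀ t, nu.toFun t = mu.toFun (t ^ N)) : Pset nu = Pset mu := by
  ext g
  rw [mem_Pset_iff, mem_Pset_iff]
  refine and_congr_right fun hg => ⟨?_, ?_⟩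
  · rintro ⟨q, hq⟩
    obtain ⟨D, A, hA⟩ := conj_clear mu (g : Matrix (Fin G.n) (Fin G.n) k)
    have h1 : (expand k N).mapMatrix A = (X ^ (D * N) : k[X]) • q := by
      refine matP_ext _ _ fun t => ?_
      rw [mapMatrix_comp_apply, evP_expand, ← Units.val_pow_eq_pow_val, hA, ← h]
      have h2 := hq t
      ext i j
      have h3 := congrFun (congrFun h2 i) j
      simp only [AlgHom.mapMatrix_apply, Matrix.map_apply, Units.val_mul] at h3
      simp only [AlgHom.mapMatrix_apply, Matrix.map_apply, Matrix.smul_apply, smul_eq_mul, map_mul,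
        h3]
      simp only [evP_apply, eval_pow, eval_X, Units.val_pow_eq_pow_val]
      rw [← pow_mul, mul_comm N D]
    have h2 : ∀ i j, X ^ D ∣ A i j := by
      intro i j
      rw [X_pow_dvd_iff]
      intro d hd
      have h3 := congrArg (fun p : k[X] => p.coeff (d * N)) (congrFun (congrFun h1 i) j)
      simp only [AlgHom.mapMatrix_apply, Matrix.map_apply, Matrix.smul_apply, smul_eq_mul] at h3
      rw [coeff_expand_mul hN, coeff_X_pow_mul', if_neg] at h3
      · exact h3
      · exact not_le.2 (Nat.mul_lt_mul_of_pos_right hd hN)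
    choose a ha using h2
    refine ⟨Matrix.of a, fun t => ?_⟩
    ext i j
    have h3 := congrFun (congrFun (hA t) i) j
    simp only [AlgHom.mapMatrix_apply, Matrix.map_apply, Matrix.smul_apply, smul_eq_mul, ha] at h3
    simp only [evP_apply, eval_mul, eval_pow, eval_X] at h3
    simp only [AlgHom.mapMatrix_apply, Matrix.map_apply, Matrix.of_apply, evP_apply, Units.val_mul]
    exact mul_left_cancel₀ (pow_ne_zero _ t.ne_zero) h3
  · rintro ⟨q, hq⟩
    refine ⟨(expand k N).mapMatrix q, fun t => ?_⟩
    rw [mapMatrix_comp_apply, evP_expand, ← Units.val_pow_eq_pow_val, hq, h]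

lemma Lset_pow {k : Type} [Field k] [IsAlgClosed k] [CharZero k] {G : AlgGroup k} (mu nu : OnePS G)
    (N : ℕ) (hN : 0 < N) (h : ∀ t, nu.toFun t = mu.toFun (t ^ N)) : Lset nu = Lset mu := by
  ext g
  rw [mem_Lset_iff, mem_Lset_iff]
  refine and_congr_right fun hg => ⟨?_, ?_⟩
  · intro h1 s
    obtain ⟨t, ht⟩ := IsAlgClosed.exists_pow_nat_eq (s : k) hN
    have ht0 : t ≠ 0 := by
      rintro rfl
      rw [zero_pow hN.ne'] at ht
      exact s.ne_zero ht.symm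
    have : s = (Units.mk0 t ht0) ^ N := by
      ext
      simp [ht]
    rw [this, ← h]
    exact h1 _
  · intro h1 s
    rw [h]
    exact h1 _


/-- the exponential of a nilpotent matrix -/
noncomputable def expU {R : Type} [CommRing R] [Algebra ℚ R] {n : ℕ} (M : Matrix (Fin n) (Fin n) R)
    (hM : IsNilpotent M) : GL (Fin n) R :=
  ⟨IsNilpotent.exp M, IsNilpotent.exp (-M), IsNilpotent.exp_mul_exp_neg_self hM,
    IsNilpotent.exp_neg_mul_exp_self hM⟩

lemma expU_val {R : Type} [CommRing R] [Algebra ℚ R] {n : ℕ} (M : Matrix (Fin n) (Fin n) R)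
    (hM : IsNilpotent M) : (expU M hM : Matrix (Fin n) (Fin n) R) = IsNilpotent.exp M := rfl

lemma mp_expU {k R : Type} [Field k] [CharZero k] [CommRing R] [Algebra k R] [Algebra ℚ R] {n : ℕ}
    (e : R →ₐ[k] k) (M : Matrix (Fin n) (Fin n) R)
    (hM : IsNilpotent M) : (mp e (expU M hM) : Matrix (Fin n) (Fin n) k) =
      IsNilpotent.exp (e.mapMatrix M) := by
  rw [mp_val, expU_val]
  exact IsNilpotent.map_exp hM e.mapMatrix

lemma exp_nat_smul {A : Type} [Ring A] [Algebra ℚ A] (Y : A) (hY : IsNilpotent Y) (m : ℕ) :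
    IsNilpotent.exp (m • Y) = IsNilpotent.exp Y ^ m := by
  induction m with
  | zero => simp [IsNilpotent.exp_zero]
  | succ m ih =>
    rw [add_smul, one_smul, IsNilpotent.exp_add_of_commute ((Commute.refl Y).smul_left m)
      (hY.smul m) hY, ih, pow_succ]

lemma nilp_smul_cst {k R : Type} [Field k] [CommRing R] [Algebra k R] {n : ℕ} (r : R)
    (Y : Matrix (Fin n) (Fin n) k) (hY : IsNilpotent Y) : IsNilpotent (r • cstM R Y) := by
  exact (hY.map (cstM R)).smul r

lemma map_smul_cst {k R : Type} [Field k] [CommRing R] [Algebra k R] {n : ℕ} (e : R →ₐ[k] k) (r : R)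
    (M : Matrix (Fin n) (Fin n) R) : e.mapMatrix (r • M) = e r • e.mapMatrix M := by
  ext i j
  simp

lemma mp_diagGL {k R : Type} [Field k] [CommRing R] [Algebra k R] {n : ℕ} (e : R →ₐ[k] k)
    (d : Fin n → Rˣ) : (mp e (diagGL d) : Matrix (Fin n) (Fin n) k) =
      Matrix.diagonal (fun i => e (d i : R)) := by
  rw [mp_val, diagGL_val, AlgHom.mapMatrix_apply, Matrix.diagonal_map (map_zero e)]

lemma jordan_hat {k : Type} [Field k] [CharZero k] (G : AlgGroup k)
    (g : GL (Fin G.n) k) (hg : g ∈ G.toSubgroup) (Q : GL (Fin G.n) k) (d : Fin G.n → kˣ)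
    (Y : Matrix (Fin G.n) (Fin G.n) k) (hY : IsNilpotent Y)
    (h1 : (g : Matrix (Fin G.n) (Fin G.n) k) =
      (Q * diagGL d * Q⁻¹ : GL (Fin G.n) k) * IsNilpotent.exp Y)
    (h2 : Commute ((Q * diagGL d * Q⁻¹ : GL (Fin G.n) k) : Matrix (Fin G.n) (Fin G.n) k) Y)
    (Γ : Subgroup kˣ) (hd : ∀ i, d i ∈ Γ) :
    ∃ gh : GL (Fin G.n) (MonoidAlgebra k[X] Γ),
      (∀ (θ : Γ →* k) (b : k), (mp (evE θ b) gh : Matrix (Fin G.n) (Fin G.n) k) =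
        (Q : Matrix (Fin G.n) (Fin G.n) k) * Matrix.diagonal (fun i => θ ⟨d i, hd i⟩) *
          ((Q⁻¹ : GL (Fin G.n) k) : Matrix (Fin G.n) (Fin G.n) k) * IsNilpotent.exp (b • Y)) ∧
      (∀ m : ℕ, mp (evE (stdChar Γ ^ m) (m : k)) gh = g ^ m) ∧
      (∀ (θ : Γ →* k) (b : k), mp (evE θ b) gh ∈ G.toSubgroup) := by
  let R := MonoidAlgebra k[X] Γ
  let dh : Fin G.n → Rˣ := fun i => Units.map (MonoidAlgebra.of k[X] Γ) (toUnits ⟨d i, hd i⟩)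
  let r : R := MonoidAlgebra.single 1 X
  let gh : GL (Fin G.n) R := cst R Q * diagGL dh * (cst R Q)⁻¹ *
    expU (r • cstM R Y) (nilp_smul_cst r Y hY)
  have e1 : ∀ (θ : Γ →* k) (b : k), (mp (evE θ b) gh : Matrix (Fin G.n) (Fin G.n) k) =
        (Q : Matrix (Fin G.n) (Fin G.n) k) * Matrix.diagonal (fun i => θ ⟨d i, hd i⟩) *
          ((Q⁻¹ : GL (Fin G.n) k) : Matrix (Fin G.n) (Fin G.n) k) * IsNilpotent.exp (b • Y) := by
    intro θ b
    simp only [gh, map_mul, map_inv, Units.val_mul]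
    rw [mp_diagGL, mp_expU, map_smul_cst, map_cstM]
    have hr : evE θ b r = b := by simp [r, evE_single]
    have hdh : ∀ i, evE θ b (dh i : R) = θ ⟨d i, hd i⟩ := by
      intro i
      change evE θ b (MonoidAlgebra.single _ 1) = _
      rw [evE_single, eval_one, one_mul]
      rfl
    have hQ : mp (evE θ b) (cst R Q) = Q := mp_cst _ _
    simp only [hr, hdh]
    rw [hQ]
  have e2 : ∀ m : ℕ, mp (evE (stdChar Γ ^ m) (m : k)) gh = g ^ m := by
    intro m
    ext1
    have h3 : ((Q * diagGL d * Q⁻¹ : GL (Fin G.n) k) : Matrix (Fin G.n) (Fin G.n) k) ^ m =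
        (Q : Matrix (Fin G.n) (Fin G.n) k) * Matrix.diagonal (fun i => (d i : k) ^ m) *
          ((Q⁻¹ : GL (Fin G.n) k) : Matrix (Fin G.n) (Fin G.n) k) := by
      rw [← Units.val_pow_eq_pow_val, conj_pow, ← map_pow, Units.val_mul, Units.val_mul, diagGL_val]
      rfl
    have h4 : Commute ((Q * diagGL d * Q⁻¹ : GL (Fin G.n) k) : Matrix (Fin G.n) (Fin G.n) k)
        (IsNilpotent.exp Y) := by
      rw [IsNilpotent.exp]
      exact Commute.sum_right _ _ _ fun i _ => ((h2.pow_right i).smul_right _)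
    rw [e1, Units.val_pow_eq_pow_val, h1, h4.mul_pow, h3, ← exp_nat_smul Y hY, Nat.cast_smul_eq_nsmul]
    rfl
  refine ⟨gh, e1, e2, ?_⟩
  intro θ b
  refine mem_of_jointly G gh (fun m : ℕ => evE (stdChar Γ ^ m) (m : k)) evE_injective (fun m => ?_) _
  rw [e2]
  exact pow_mem hg m


/-- Laurent polynomials evaluated at a unit -/
noncomputable def lau {k R : Type} [Field k] [CommRing R] [Algebra k R] (u : Rˣ) :
    LaurentPolynomial k →ₐ[k] R :=
  { LaurentPolynomial.eval₂ (algebraMap k R) u with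
    commutes' := fun r => by
      simp [← LaurentPolynomial.C_eq_algebraMap] }

lemma lau_T {k R : Type} [Field k] [CommRing R] [Algebra k R] (u : Rˣ) (n : ℤ) :
    lau (k := k) u (LaurentPolynomial.T n) = ((u ^ n : Rˣ) : R) :=
  LaurentPolynomial.eval₂_T _ _ _

lemma comp_lau {k R : Type} [Field k] [CommRing R] [Algebra k R] (u : Rˣ) (e : R →ₐ[k] k) :
    e.comp (lau u) = evL (Units.map (e : R →* k) u) := by
  apply AddMonoidAlgebra.algHom_ext
  case single_zero_left => exact Subsingleton.elim _ _
  intro n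
  have h1 : (e.comp (lau u)) (LaurentPolynomial.T n) = evL (Units.map (e : R →* k) u) (LaurentPolynomial.T n) := by
    rw [AlgHom.comp_apply, lau_T, evL_T, ← map_zpow]
    rfl
  exact h1

lemma exists_lift {k : Type} [Field k] [IsAlgClosed k] [CharZero k] {G Gq : AlgGroup k}
    (phi : AlgGroupHom G Gq) (hsurj : phi.Surj) (mu : OnePS Gq) :
    ∃ (lam : OnePS G) (N : ℕ), 0 < N ∧ ∀ t, (compPS phi lam).toFun t = mu.toFun (t ^ N) := by
  let two : kˣ := Units.mk0 2 two_ne_zero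
  obtain ⟨g, hg, hgm⟩ := hsurj (mu.toFun two) (mu.mem two)
  obtain ⟨Q, d, Y, hY, h1, h2⟩ := exists_jordan g
  let Γ : Subgroup kˣ := Subgroup.closure (Set.range d ∪ {two})
  have hd : ∀ i, d i ∈ Γ := fun i => Subgroup.subset_closure (Or.inl ⟨i, rfl⟩)
  have htwo : two ∈ Γ := Subgroup.subset_closure (Or.inr rfl)
  have hfg : Group.FG Γ := by
    rw [Group.fg_iff_subgroup_fg, Subgroup.fg_iff]
    exact ⟨_, rfl, (Set.finite_range d).union (Set.finite_singleton _)⟩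
  obtain ⟨e, he⟩ := exists_hom_int hfg (⟨two, htwo⟩ : Γ) (by
    intro n hn h
    have h3 : ((two ^ n : kˣ) : k) = 1 := by
      have := congrArg (Subtype.val) h
      exact congrArg Units.val this
    have h4 : (2 : k) ^ n = 1 := h3
    have h5 : (2 : ℕ) ^ n = 1 := by exact_mod_cast h4
    exact absurd h5 (Nat.one_lt_two_pow hn.ne').ne')
  obtain ⟨gh, hgh1, hgh2, hgh3⟩ := jordan_hat G g hg Q d Y hY h1 h2 Γ hd
  obtain ⟨muh, hmuh⟩ := exists_hat mu
  obtain ⟨F, hF⟩ := phi_ext phi gh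
  let u : (MonoidAlgebra k[X] Γ)ˣ := Units.map (MonoidAlgebra.of k[X] Γ) (toUnits ⟨two, htwo⟩)
  have hu : ∀ θ b, evE θ b (u : MonoidAlgebra k[X] Γ) = θ ⟨two, htwo⟩ := by
    intro θ b
    change evE θ b (MonoidAlgebra.single _ 1) = _
    rw [evE_single, eval_one, one_mul]
    rfl
  have hFu : F = (lau u).mapMatrix (muh : Matrix (Fin Gq.n) (Fin Gq.n) (LaurentPolynomial k)) := by
    refine mat_ext (fun m : ℕ => evE (stdChar Γ ^ m) (m : k)) evE_injective _ _ fun m => ?_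
    rw [← hF _ (hgh3 _ _), hgh2, mapMatrix_comp_apply, comp_lau, phi_pow phi hg, hgm, ← map_pow,
      ← hmuh]
    have : two ^ m = Units.map ((evE (stdChar Γ ^ m) (m : k) : MonoidAlgebra k[X] Γ →ₐ[k] k) :
        MonoidAlgebra k[X] Γ →* k) u := by
      ext
      refine Eq.trans ?_ (hu _ _).symm
      rfl
    rw [this]
    rfl
  let ch : kˣ → Γ →* k := fun t => (Units.coeHom k).comp ((zpowersHom kˣ t).comp e)
  have hch : ∀ t γ, ch t γ = ((t ^ (e γ).toAdd : kˣ) : k) := by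
    intro t γ
    rfl
  let ex : Fin G.n → ℤ := fun i => (e ⟨d i, hd i⟩).toAdd
  let lf : kˣ →* GL (Fin G.n) k :=
    { toFun := fun t => Q * diagGL (fun i => t ^ ex i) * Q⁻¹
      map_one' := by
        have : (fun i => (1 : kˣ) ^ ex i) = 1 := by
          funext i
          simp
        rw [this, map_one]
        simp
      map_mul' := fun s t => by
        have : (fun i => (s * t) ^ ex i) = (fun i => s ^ ex i) * (fun i => t ^ ex i) := by
          funext i
          simp [mul_zpow]
        rw [this, map_mul]
        group }
  have hlf : ∀ t, lf t = mp (evE (ch t) 0) gh := by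
    intro t
    ext1
    rw [hgh1, zero_smul, IsNilpotent.exp_zero, mul_one]
    change ((Q * diagGL (fun i => t ^ ex i) * Q⁻¹ : GL (Fin G.n) k) : Matrix (Fin G.n) (Fin G.n) k) = _
    rw [Units.val_mul, Units.val_mul, diagGL_val]
    rfl
  have hreg := mp_regular (fun t => (lf t : Matrix (Fin G.n) (Fin G.n) k))
    (cstM (LaurentPolynomial k) (Q : Matrix (Fin G.n) (Fin G.n) k) *
      Matrix.diagonal (fun i => LaurentPolynomial.T (ex i)) *
      cstM (LaurentPolynomial k) ((Q⁻¹ : GL (Fin G.n) k) : Matrix (Fin G.n) (Fin G.n) k)) (by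
      intro t
      change ((Q * diagGL (fun i => t ^ ex i) * Q⁻¹ : GL (Fin G.n) k) : Matrix (Fin G.n) (Fin G.n) k) = _
      rw [map_mul, map_mul, map_cstM, map_cstM, AlgHom.mapMatrix_apply, 
        Matrix.diagonal_map (map_zero (evL t)), Units.val_mul, Units.val_mul, diagGL_val]
      simp only [evL_T])
  let lam : OnePS G := ⟨lf, fun t => by rw [hlf]; exact hgh3 _ _, hreg⟩
  refine ⟨lam, (e ⟨two, htwo⟩).toAdd.toNat, by omega, fun t => ?_⟩
  ext1
  rw [compPS_apply]
  change (phi.toFun (lf t) : Matrix (Fin Gq.n) (Fin Gq.n) k) = _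
  rw [hlf, hF _ (hgh3 _ _), hFu, mapMatrix_comp_apply, comp_lau, ← hmuh]
  have : t ^ (e ⟨two, htwo⟩).toAdd.toNat =
      Units.map ((evE (ch t) 0 : MonoidAlgebra k[X] Γ →ₐ[k] k) : MonoidAlgebra k[X] Γ →* k) u := by
    ext
    refine Eq.trans ?_ (hu _ _).symm
    rw [hch, ← zpow_natCast, Int.toNat_of_nonneg he.le]
  rw [this]
  rfl


/-- conjugation as an algebra homomorphism -/
def cj {k : Type} [Field k] {n : ℕ} (g : GL (Fin n) k) :
    Matrix (Fin n) (Fin n) k →ₐ[k] Matrix (Fin n) (Fin n) k :=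
  AlgHom.ofLinearMap
    ((LinearMap.mulLeft k (g : Matrix (Fin n) (Fin n) k)).comp
      (LinearMap.mulRight k ((g⁻¹ : GL (Fin n) k) : Matrix (Fin n) (Fin n) k)))
    (by
      simp only [LinearMap.comp_apply, LinearMap.mulLeft_apply, LinearMap.mulRight_apply, one_mul]
      rw [← Units.val_mul, mul_inv_cancel, Units.val_one])
    (by
      intro x y
      simp only [LinearMap.comp_apply, LinearMap.mulLeft_apply, LinearMap.mulRight_apply]
      have : ((g⁻¹ : GL (Fin n) k) : Matrix (Fin n) (Fin n) k) * (g : Matrix (Fin n) (Fin n) k) = 1 := by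
        rw [← Units.val_mul, inv_mul_cancel, Units.val_one]
      calc _ = (g : Matrix (Fin n) (Fin n) k) * x * (1 * y *
            ((g⁻¹ : GL (Fin n) k) : Matrix (Fin n) (Fin n) k)) := by simp only [mul_assoc, one_mul]
        _ = _ := by rw [← this]; simp only [mul_assoc])

lemma cj_apply {k : Type} [Field k] {n : ℕ} (g : GL (Fin n) k) (M : Matrix (Fin n) (Fin n) k) :
    cj g M = (g : Matrix (Fin n) (Fin n) k) * M * ((g⁻¹ : GL (Fin n) k) : Matrix (Fin n) (Fin n) k) :=
  (mul_assoc _ _ _).symm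

lemma cj_val {k : Type} [Field k] {n : ℕ} (g h : GL (Fin n) k) :
    cj g (h : Matrix (Fin n) (Fin n) k) = ((g * h * g⁻¹ : GL (Fin n) k) : Matrix (Fin n) (Fin n) k) := by
  rw [cj_apply]
  rfl

lemma exp_inj {k : Type} [Field k] [CharZero k] {n : ℕ} (P P' : Matrix (Fin n) (Fin n) k)
    (hP : IsNilpotent P) (hP' : IsNilpotent P')
    (h : ∀ b : k, IsNilpotent.exp (b • P) = IsNilpotent.exp (b • P')) : P = P' := by
  have key : ∀ P : Matrix (Fin n) (Fin n) k, IsNilpotent P → ∀ i j,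
      (IsNilpotent.exp ((X : k[X]) • cstM k[X] P) i j).coeff 1 = P i j := by
    intro P hP i j
    obtain ⟨r, hr⟩ := hP
    have hr' : ((X : k[X]) • cstM k[X] P) ^ (r + 2) = 0 := by
      rw [_root_.smul_pow, ← map_pow, pow_add P, hr, zero_mul, map_zero, smul_zero]
    rw [IsNilpotent.exp_eq_sum hr', Matrix.sum_apply, finsetSum_coeff,
      Finset.sum_eq_single_of_mem 1 (by simp)]
    · simp only [Nat.factorial_one, Nat.cast_one, inv_one, one_smul, pow_one, Matrix.smul_apply,
        smul_eq_mul]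
      rw [coeff_X_mul]
      change (C (P i j)).coeff 0 = _
      rw [coeff_C_zero]
    · intro m _ hm
      rw [_root_.smul_pow, ← map_pow, Matrix.smul_apply, Matrix.smul_apply, smul_eq_mul]
      change ((m.factorial : ℚ)⁻¹ • (X ^ m * C ((P ^ m) i j))).coeff 1 = 0
      rw [coeff_smul, mul_comm, coeff_C_mul_X_pow, if_neg (Ne.symm hm), smul_zero]
  have h2 : IsNilpotent.exp ((X : k[X]) • cstM k[X] P) = IsNilpotent.exp ((X : k[X]) • cstM k[X] P') := by
    refine matP_ext _ _ fun t => ?_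
    rw [IsNilpotent.map_exp (nilp_smul_cst _ _ hP), IsNilpotent.map_exp (nilp_smul_cst _ _ hP'),
      map_smul_cst, map_smul_cst, map_cstM, map_cstM, evP_apply, eval_X, h]
  ext i j
  rw [← key P hP, ← key P' hP', h2]

lemma charpoly_limit {k : Type} [Field k] [Infinite k] {n : ℕ} (B : GL (Fin n) k)
    (f : kˣ → GL (Fin n) k) (q : Matrix (Fin n) (Fin n) k[X])
    (hq : ∀ t : kˣ, (evP (t : k)).mapMatrix q = ((f t * B * (f t)⁻¹ : GL (Fin n) k) : Matrix _ _ k))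
    (h0 : (evP 0).mapMatrix q = 1) : ((B : Matrix (Fin n) (Fin n) k) - 1) ^ n = 0 := by
  have h1 : ∀ t : k, ((evP t).mapMatrix q).charpoly = q.charpoly.map (evP t : k[X] →+* k) := by
    intro t
    exact Matrix.charpoly_map q (evP t : k[X] →+* k)
  have h2 : ∀ t : kˣ, ((evP (t : k)).mapMatrix q).charpoly = (B : Matrix (Fin n) (Fin n) k).charpoly := by
    intro t
    rw [hq]
    have h9 := Matrix.charpoly_units_conj (f t) (B : Matrix (Fin n) (Fin n) k)
    rw [← Matrix.coe_units_inv] at h9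
    exact h9
  have h3 : (B : Matrix (Fin n) (Fin n) k).charpoly = (1 : Matrix (Fin n) (Fin n) k).charpoly := by
    ext j
    have h4 : q.charpoly.coeff j = C ((B : Matrix (Fin n) (Fin n) k).charpoly.coeff j) := by
      refine poly_eq_of_units _ _ fun t => ?_
      rw [eval_C, ← h2 t, h1, coeff_map, ← evP_apply]
      rfl
    rw [← h0, h1, coeff_map, h4]
    exact ((evP_apply _ _).trans eval_C).symm
  have h5 := Matrix.aeval_self_charpoly (B : Matrix (Fin n) (Fin n) k)
  rw [h3, Matrix.charpoly_one] at h5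
  simpa using h5

lemma aeval_nilp {k A : Type} [Field k] [Ring A] [Algebra k A] (l : k[X]) (hl : X ∣ l) (N : A)
    (n : ℕ) (hN : N ^ n = 0) : IsNilpotent (aeval N l) := by
  obtain ⟨l', rfl⟩ := hl
  refine ⟨n, ?_⟩
  rw [← map_pow, mul_pow, map_mul, map_pow, aeval_X, hN, zero_mul]

lemma center_sub_Lset {k : Type} [Field k] [Infinite k] {G : AlgGroup k} (lam : OnePS G)
    {g : GL (Fin G.n) k} (hg : g ∈ centerSet G) : g ∈ Lset lam := by
  rw [mem_Lset_iff]
  exact ⟨hg.1, fun s => (hg.2 _ (lam.mem s)).symm⟩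

/-- the one-parameter unipotent group of `Y` lies in `P(lam)` -/
lemma unip_aux {k : Type} [Field k] [CharZero k] {G Gq : AlgGroup k} (phi : AlgGroupHom G Gq)
    (hker : ∀ g ∈ G.toSubgroup, (phi.toFun g = 1 ↔ g ∈ centerSet G))
    (lam : OnePS G) (Y : Matrix (Fin G.n) (Fin G.n) k) (hY : IsNilpotent Y)
    (U : k → GL (Fin G.n) k) (hU : ∀ b, U b ∈ G.toSubgroup)
    (hUv : ∀ b, (U b : Matrix (Fin G.n) (Fin G.n) k) = IsNilpotent.exp (b • Y))
    (W : Matrix (Fin Gq.n) (Fin Gq.n) k) (hW : IsNilpotent W)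
    (hUW : ∀ b, (phi.toFun (U b) : Matrix (Fin Gq.n) (Fin Gq.n) k) = IsNilpotent.exp (b • W))
    (Wq : Matrix (Fin Gq.n) (Fin Gq.n) k[X]) (hWqn : IsNilpotent Wq)
    (hWq : ∀ t : kˣ, (evP (t : k)).mapMatrix Wq = cj ((compPS phi lam).toFun t) W) :
    U 1 ∈ Pset lam := by
  classical
  have hex : ∃ d : ℕ, ∃ A : Matrix (Fin G.n) (Fin G.n) k[X], ∀ t : kˣ,
      (evP (t : k)).mapMatrix A = (t : k) ^ d • ((lam.toFun t : Matrix _ _ k) * Y *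
        (((lam.toFun t)⁻¹ : GL (Fin G.n) k) : Matrix _ _ k)) := conj_clear lam Y
  obtain ⟨A, hA⟩ := Nat.find_spec hex
  have hmin := fun m (hm : m < Nat.find hex) => Nat.find_min hex hm
  generalize Nat.find hex = d at hA hmin
  have hA' : ∀ t : kˣ, (evP (t : k)).mapMatrix A = (t : k) ^ d • cj (lam.toFun t) Y := by
    intro t
    rw [hA, cj_apply]
  have hAn : IsNilpotent A := by
    obtain ⟨r, hr⟩ := hY
    refine ⟨r, matP_ext _ _ fun t => ?_⟩
    rw [map_pow, hA', _root_.smul_pow, ← map_pow, hr, map_zero, smul_zero, map_zero]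
  have hcU : ∀ (c : k) (t : kˣ), IsNilpotent.exp (c • cj (lam.toFun t) Y) =
      ((lam.toFun t * U c * (lam.toFun t)⁻¹ : GL (Fin G.n) k) : Matrix _ _ k) := by
    intro c t
    rw [← cj_val, hUv, IsNilpotent.map_exp (hY.smul c), map_smul]
  have hd0 : d = 0 := by
    by_contra hd
    have hlw := limit_weight lam Y d A hA
    set C0 := (evP 0).mapMatrix A with hC0
    have hC0n : IsNilpotent C0 := hAn.map (evP 0).mapMatrix
    have hcen : ∀ b : k, ∃ z ∈ centerSet G, (z : Matrix (Fin G.n) (Fin G.n) k) = IsNilpotent.exp (b • C0) := by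
      intro b
      have hbA : IsNilpotent ((C b : k[X]) • A) := hAn.smul _
      have hK : ∀ t : k, (mp (evP t) (expU _ hbA) : Matrix (Fin G.n) (Fin G.n) k) =
          IsNilpotent.exp (b • (evP t).mapMatrix A) := by
        intro t
        rw [mp_expU, map_smul_cst, evP_apply, eval_C]
      have hK1 : ∀ t : kˣ, mp (evP (t : k)) (expU _ hbA) =
          lam.toFun t * U (b * (t : k) ^ d) * (lam.toFun t)⁻¹ := by
        intro t
        ext1
        rw [hK, hA', smul_smul, hcU]
      have hK2 : ∀ t : kˣ, mp (evP (t : k)) (expU _ hbA) ∈ G.toSubgroup := by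
        intro t
        rw [hK1]
        exact mul_mem (mul_mem (lam.mem t) (hU _)) (inv_mem (lam.mem t))
      have hK3 : mp (evP 0) (expU _ hbA) ∈ G.toSubgroup :=
        mem_of_jointly G _ (fun t : kˣ => evP (t : k)) evP_inj hK2 _
      refine ⟨mp (evP 0) (expU _ hbA), ?_, hK 0⟩
      rw [← hker _ hK3]
      obtain ⟨F, hF⟩ := phi_ext phi (expU _ hbA)
      have hbW : IsNilpotent ((C b * X ^ d : k[X]) • Wq) := hWqn.smul _
      have hFW : F = IsNilpotent.exp ((C b * X ^ d : k[X]) • Wq) := by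
        refine matP_ext _ _ fun t => ?_
        rw [← hF _ (hK2 t), hK1, IsNilpotent.map_exp hbW, map_smul_cst, hWq, evP_apply, eval_mul,
          eval_C, eval_pow, eval_X, phi.map_mul _ (mul_mem (lam.mem t) (hU _)) _ (inv_mem (lam.mem t)),
          phi.map_mul _ (lam.mem t) _ (hU _), phi_inv phi (lam.mem t), ← compPS_apply, ← cj_val, hUW,
          IsNilpotent.map_exp (hW.smul _), map_smul]
      ext1
      rw [hF _ hK3, hFW, IsNilpotent.map_exp hbW, map_smul_cst, evP_apply, eval_mul, eval_pow, eval_X,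
        zero_pow hd, mul_zero, zero_smul, IsNilpotent.exp_zero, Units.val_one]
    have hfix : ∀ s : kˣ, cj (lam.toFun s) C0 = C0 := by
      intro s
      refine exp_inj _ _ (hC0n.map _) hC0n fun b => ?_
      obtain ⟨z, hz, hzv⟩ := hcen b
      rw [← map_smul, ← IsNilpotent.map_exp (hC0n.smul b), ← hzv, cj_val, ← hz.2 _ (lam.mem s),
        mul_inv_cancel_right]
    have hC00 : C0 = 0 := by
      have h1 := hlw (Units.mk0 2 two_ne_zero)
      rw [← cj_apply, hfix] at h1
      have h2 : ((2 : k) ^ d - 1) • C0 = 0 := by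
        rw [sub_smul, one_smul, sub_eq_zero]
        exact h1
      refine (smul_eq_zero.1 h2).resolve_left ?_
      refine sub_ne_zero.2 ?_
      have := (Nat.one_lt_two_pow hd).ne'
      exact_mod_cast this
    have hdvd : ∀ i j, X ∣ A i j := by
      intro i j
      rw [X_dvd_iff, coeff_zero_eq_eval_zero, ← evP_apply]
      exact congrFun (congrFun hC00 i) j
    choose A' hA2 using hdvd
    refine hmin (d - 1) (by omega) ⟨Matrix.of A', fun t => ?_⟩
    have hXA : A = (X : k[X]) • Matrix.of A' := by
      ext1 i j
      rw [hA2]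
      rfl
    have h3 := hA t
    rw [hXA, map_smul_cst, evP_apply, eval_X] at h3
    have h4 : (t : k) ^ d = (t : k) * (t : k) ^ (d - 1) := by
      rw [← pow_succ']
      congr 1
      omega
    rw [h4, mul_smul] at h3
    exact smul_right_injective _ t.ne_zero h3
  subst hd0
  rw [mem_Pset_iff]
  refine ⟨hU 1, IsNilpotent.exp A, fun t => ?_⟩
  rw [IsNilpotent.map_exp hAn, hA', pow_zero, hcU]

set_option maxHeartbeats 2000000 in
lemma Pset_unip {k : Type} [Field k] [IsAlgClosed k] [CharZero k] {G Gq : AlgGroup k}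
    (phi : AlgGroupHom G Gq)
    (hker : ∀ g ∈ G.toSubgroup, (phi.toFun g = 1 ↔ g ∈ centerSet G))
    (lam : OnePS G) {g : GL (Fin G.n) k} (hg : g ∈ G.toSubgroup)
    (q : Matrix (Fin Gq.n) (Fin Gq.n) k[X])
    (hq : ∀ t : kˣ, (evP (t : k)).mapMatrix q = (((compPS phi lam).toFun t * phi.toFun g *
      ((compPS phi lam).toFun t)⁻¹ : GL (Fin Gq.n) k) : Matrix _ _ k))
    (h0 : (evP 0).mapMatrix q = 1) : g ∈ Pset lam := by
  set B := phi.toFun g with hB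
  have hBn := charpoly_limit B (fun t => (compPS phi lam).toFun t) q hq h0
  obtain ⟨l, hl, hlog⟩ := exists_log (k := k) Gq.n
  set N : Matrix (Fin Gq.n) (Fin Gq.n) k := (B : Matrix (Fin Gq.n) (Fin Gq.n) k) - 1 with hN
  set W := aeval N l with hWdef
  have hW : IsNilpotent W := aeval_nilp l hl _ _ hBn
  have hexpW : IsNilpotent.exp W = (B : Matrix (Fin Gq.n) (Fin Gq.n) k) := by
    rw [hlog _ _ hBn]
    simp [hN]
  have hq1 : ∀ t : kˣ, (evP (t : k)).mapMatrix (q - 1) = cj ((compPS phi lam).toFun t) N := by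
    intro t
    rw [map_sub, hq, map_one, ← cj_val, hN, map_sub, map_one]
  have hqn : (q - 1) ^ Gq.n = 0 := by
    refine matP_ext _ _ fun t => ?_
    rw [map_pow, hq1, ← map_pow, hBn, map_zero, map_zero]
  obtain ⟨Q, d, Y, hY, h1, h2⟩ := exists_jordan g
  obtain ⟨gh, hgh1, hgh2, hgh3⟩ := jordan_hat G g hg Q d Y hY h1 h2 ⊤ (fun i => Subgroup.mem_top _)
  obtain ⟨F, hF⟩ := phi_ext phi gh
  let io : k[X] →ₐ[k] MonoidAlgebra k[X] (⊤ : Subgroup kˣ) := MonoidAlgebra.singleOneAlgHom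
  have hio : ∀ θ b, (evE θ b).comp io = evP b := by
    intro θ b
    apply AlgHom.ext
    intro p
    change evE θ b (MonoidAlgebra.single 1 p) = _
    rw [evE_single, map_one, mul_one, evP_apply]
  have hXW : IsNilpotent ((X : k[X]) • cstM k[X] W) := nilp_smul_cst _ _ hW
  have hev : ∀ b, (evP b).mapMatrix (IsNilpotent.exp ((X : k[X]) • cstM k[X] W)) =
      IsNilpotent.exp (b • W) := by
    intro b
    rw [IsNilpotent.map_exp hXW, map_smul_cst, map_cstM, evP_apply, eval_X]
  have hFW : F = io.mapMatrix (IsNilpotent.exp ((X : k[X]) • cstM k[X] W)) := by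
    refine mat_ext (fun m : ℕ => evE (stdChar (⊤ : Subgroup kˣ) ^ m) (m : k)) evE_injective _ _
      fun m => ?_
    rw [← hF _ (hgh3 _ _), hgh2, mapMatrix_comp_apply, hio, hev, Nat.cast_smul_eq_nsmul,
      exp_nat_smul W hW, hexpW, phi_pow phi hg, Units.val_pow_eq_pow_val]
  have hphi : ∀ θ b, (phi.toFun (mp (evE θ b) gh) : Matrix (Fin Gq.n) (Fin Gq.n) k) =
      IsNilpotent.exp (b • W) := by
    intro θ b
    rw [hF _ (hgh3 _ _), hFW, mapMatrix_comp_apply, hio, hev]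
  obtain ⟨U, hUd⟩ : ∃ U : k → GL (Fin G.n) k,
      ∀ b, U b = mp (evE (1 : (⊤ : Subgroup kˣ) →* k) b) gh := ⟨_, fun _ => rfl⟩
  obtain ⟨Wq, hWqd⟩ : ∃ Wq : Matrix (Fin Gq.n) (Fin Gq.n) k[X], Wq = aeval (q - 1) l := ⟨_, rfl⟩
  have hU1 : ∀ b, U b ∈ G.toSubgroup := by
    intro b
    rw [hUd]
    exact hgh3 1 b
  have hU3 : ∀ b, (phi.toFun (U b) : Matrix (Fin Gq.n) (Fin Gq.n) k) = IsNilpotent.exp (b • W) := by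
    intro b
    rw [hUd]
    exact hphi 1 b
  have hU2 : ∀ b, (U b : Matrix (Fin G.n) (Fin G.n) k) = IsNilpotent.exp (b • Y) := by
    intro b
    rw [hUd, hgh1]
    have : (Matrix.diagonal fun i : Fin G.n => (1 : (⊤ : Subgroup kˣ) →* k) ⟨d i, Subgroup.mem_top _⟩) = 1 := by
      simp only [MonoidHom.one_apply]
      exact Matrix.diagonal_one
    rw [this, mul_one, ← Units.val_mul, mul_inv_cancel, Units.val_one, one_mul]
  have hWqn : IsNilpotent Wq := by
    rw [hWqd]
    exact aeval_nilp l hl _ _ hqn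
  have hWq : ∀ t : kˣ, (evP (t : k)).mapMatrix Wq = cj ((compPS phi lam).toFun t) W := by
    intro t
    rw [hWqd]
    refine (Polynomial.aeval_algHom_apply ((evP (t : k)).mapMatrix) (q - 1) l).symm.trans ?_
    rw [hq1]
    exact Polynomial.aeval_algHom_apply (cj ((compPS phi lam).toFun t)) N l
  have hU : mp (evE 1 1) gh ∈ Pset lam := by
    rw [← hUd]
    exact unip_aux phi hker lam Y hY U hU1 hU2 W hW hU3 Wq hWqn hWq
  have hs : mp (evE (stdChar ⊤) 0) gh ∈ Pset lam := by
    refine Lset_sub_Pset lam (center_sub_Lset lam ?_)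
    rw [← hker _ (hgh3 _ _)]
    ext1
    rw [hphi, zero_smul, IsNilpotent.exp_zero, Units.val_one]
  have hgs : g = mp (evE (stdChar ⊤) 0) gh * mp (evE 1 1) gh := by
    ext1
    rw [Units.val_mul, hgh1, hgh1, zero_smul, IsNilpotent.exp_zero, mul_one]
    have : (Matrix.diagonal fun i : Fin G.n => (1 : (⊤ : Subgroup kˣ) →* k) ⟨d i, Subgroup.mem_top _⟩) = 1 := by
        simp only [MonoidHom.one_apply]
        exact Matrix.diagonal_one
    rw [this, mul_one, ← Units.val_mul, mul_inv_cancel, Units.val_one, one_mul, one_smul, h1,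
      Units.val_mul, Units.val_mul, diagGL_val]
    rfl
  rw [hgs]
  exact Pset_mul lam hs hU

lemma Pset_of_map {k : Type} [Field k] [IsAlgClosed k] [CharZero k] {G Gq : AlgGroup k}
    (phi : AlgGroupHom G Gq) (hsurj : phi.Surj)
    (hker : ∀ g ∈ G.toSubgroup, (phi.toFun g = 1 ↔ g ∈ centerSet G))
    (lam : OnePS G) {g : GL (Fin G.n) k} (hg : g ∈ G.toSubgroup)
    (h : phi.toFun g ∈ Pset (compPS phi lam)) : g ∈ Pset lam := by
  rw [mem_Pset_iff] at h
  obtain ⟨hg1, q, hq⟩ := h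
  obtain ⟨qh, e1, e2, -, e3⟩ := mem_Pset_of _ hg1 q hq
  obtain ⟨a, ha, hap⟩ := hsurj _ e2
  have haL : a ∈ Lset lam := by
    refine Lset_of_map phi hker lam ha ?_
    rw [mem_Lset_iff, hap]
    exact ⟨e2, e3⟩
  have hga : g * a⁻¹ ∈ Pset lam := by
    refine Pset_unip phi hker lam (mul_mem hg (inv_mem ha))
      ((qh * cst k[X] (mp (evP 0) qh)⁻¹ : GL (Fin Gq.n) k[X]) : Matrix (Fin Gq.n) (Fin Gq.n) k[X])
      (fun t => ?_) ?_
    · rw [← mp_val, map_mul (mp (evP (t : k))), mp_cst, e1, phi.map_mul _ hg _ (inv_mem ha), phi_inv phi ha, hap]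
      congr 1
      have h4 : ((compPS phi lam).toFun t)⁻¹ * (mp (evP 0) qh)⁻¹ =
          (mp (evP 0) qh)⁻¹ * ((compPS phi lam).toFun t)⁻¹ := by
        rw [← mul_inv_rev, ← mul_inv_rev, e3]
      simp only [mul_assoc, h4]
    · rw [← mp_val, map_mul (mp (evP 0)), mp_cst, mul_inv_cancel, Units.val_one]
  have := Pset_mul lam hga (Lset_sub_Pset lam haL)
  rwa [inv_mul_cancel_right] at this


lemma Pset_eq_iff {k : Type} [Field k] [IsAlgClosed k] [CharZero k] {G Gq : AlgGroup k}
    (phi : AlgGroupHom G Gq) (hsurj : phi.Surj)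
    (hker : ∀ g ∈ G.toSubgroup, (phi.toFun g = 1 ↔ g ∈ centerSet G))
    (lam lam' : OnePS G) :
    Pset (compPS phi lam) = Pset (compPS phi lam') ↔ Pset lam = Pset lam' := by
  have key : ∀ a b : OnePS G, Pset (compPS phi a) ⊆ Pset (compPS phi b) ↔ Pset a ⊆ Pset b := by
    intro a b
    constructor
    · intro h g hg
      exact Pset_of_map phi hsurj hker b ((mem_Pset_iff a).1 hg).1 (h (Pset_map phi a hg))
    · intro h y hy
      obtain ⟨g, hg, rfl⟩ := hsurj _ ((mem_Pset_iff _).1 hy).1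
      exact Pset_map phi b (h (Pset_of_map phi hsurj hker a hg hy))
  rw [Set.Subset.antisymm_iff, Set.Subset.antisymm_iff, key, key]

lemma Pset_eq_top_iff {k : Type} [Field k] [IsAlgClosed k] [CharZero k] {G Gq : AlgGroup k}
    (phi : AlgGroupHom G Gq) (hsurj : phi.Surj)
    (hker : ∀ g ∈ G.toSubgroup, (phi.toFun g = 1 ↔ g ∈ centerSet G))
    (lam : OnePS G) :
    Pset (compPS phi lam) = (Gq.toSubgroup : Set _) ↔ Pset lam = (G.toSubgroup : Set _) := by
  constructor
  · intro h
    refine Set.Subset.antisymm (fun g hg => ((mem_Pset_iff _).1 hg).1) fun g hg => ?_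
    refine Pset_of_map phi hsurj hker lam hg ?_
    rw [h]
    exact phi.mem g hg
  · intro h
    refine Set.Subset.antisymm (fun g hg => ((mem_Pset_iff _).1 hg).1) fun y hy => ?_
    obtain ⟨g, hg, rfl⟩ := hsurj _ hy
    refine Pset_map phi lam ?_
    rw [h]
    exact hg

end Helpers

/-- Proposition A.8 of the paper. Let `G` be an affine
reductive group, `Z(G)` its center and `φ : G → G/Z(G)` the canonical
projection (modelled as a surjective morphism of algebraic groups with kernel
`Z(G)`). For a subgroup `H ⊆ G`: (i) `H` is completely reducible in `G` iff
`φ(H)` is completely reducible in `G/Z(G)`; (ii) `H` is irreducible in `G` iff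
`φ(H)` is irreducible in `G/Z(G)`. -/
theorem cr_and_irreducible_iff_image_mod_center
    {k : Type} [Field k] [IsAlgClosed k] [CharZero k]
    (G Gq : AlgGroup k) (hG : IsReductive G)
    (phi : AlgGroupHom G Gq) (hsurj : phi.Surj)
    (hker : ∀ g ∈ G.toSubgroup, (phi.toFun g = 1 ↔ g ∈ centerSet G))
    (H : Set (GL (Fin G.n) k))
    (hHsub : H ⊆ (G.toSubgroup : Set (GL (Fin G.n) k)))
    (hone : (1 : GL (Fin G.n) k) ∈ H)
    (hmul : ∀ a ∈ H, ∀ b ∈ H, a * b ∈ H)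
    (hinv : ∀ a ∈ H, a⁻¹ ∈ H) :
    (CompletelyReducible G H ↔ CompletelyReducible Gq (phi.toFun '' H)) ∧
    (IrreducibleIn G H ↔ IrreducibleIn Gq (phi.toFun '' H)) := by
  have sub_iff : ∀ lam : OnePS G, phi.toFun '' H ⊆ Pset (compPS phi lam) ↔ H ⊆ Pset lam := by
    intro lam
    rw [Set.image_subset_iff]
    exact ⟨fun h g hg => Pset_of_map phi hsurj hker lam (hHsub hg) (h hg),
      fun h g hg => Pset_map phi lam (h hg)⟩
  have lsub_iff : ∀ lam : OnePS G, phi.toFun '' H ⊆ Lset (compPS phi lam) ↔ H ⊆ Lset lam := by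
    intro lam
    rw [Set.image_subset_iff]
    exact ⟨fun h g hg => Lset_of_map phi hker lam (hHsub hg) (h hg),
      fun h g hg => Lset_map phi lam (h hg)⟩
  have lift : ∀ mu : OnePS Gq, ∃ lam : OnePS G,
      Pset (compPS phi lam) = Pset mu ∧ Lset (compPS phi lam) = Lset mu := by
    intro mu
    obtain ⟨lam, N, hN, h⟩ := exists_lift phi hsurj mu
    exact ⟨lam, Pset_pow _ _ N hN h, Lset_pow _ _ N hN h⟩
  refine ⟨⟨fun h mu hmu => ?_, fun h lam hlam => ?_⟩, ⟨fun h mu hmu => ?_, fun h lam hlam => ?_⟩⟩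
  · obtain ⟨lam, e, -⟩ := lift mu
    obtain ⟨_, ⟨lam', h1, rfl⟩, h2⟩ := h lam ((sub_iff lam).1 (e ▸ hmu))
    exact ⟨_, ⟨compPS phi lam', ((Pset_eq_iff phi hsurj hker _ _).2 h1).trans e, rfl⟩, (lsub_iff _).2 h2⟩
  · obtain ⟨_, ⟨mu, h1, rfl⟩, h2⟩ := h (compPS phi lam) ((sub_iff lam).2 hlam)
    obtain ⟨lam', e1, e2⟩ := lift mu
    exact ⟨_, ⟨lam', (Pset_eq_iff phi hsurj hker _ _).1 (e1.trans h1), rfl⟩, (lsub_iff _).1 (e2 ▸ h2)⟩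
  · obtain ⟨lam, e, -⟩ := lift mu
    rw [← e]
    exact (Pset_eq_top_iff phi hsurj hker lam).2 (h lam ((sub_iff lam).1 (e ▸ hmu)))
  · exact (Pset_eq_top_iff phi hsurj hker lam).1 (h _ ((sub_iff lam).2 hlam))

end PaperGIT
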